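/- Let p be a prime with p ≥ 3, let R be a noetherian complete local ring with maximal ideal 𝔪 and perfect residue field k of characteristic p, let 𝔟 ⊆ 𝔪 be an ideal with 𝔟² = 0, and set R' = R/𝔟. Let 𝓕' = (𝕎(R), Ĩ, R', f, f̃₁) be the frame with Ĩ = 𝕀_R + Ŵ(𝔟) and f̃₁ the unique f-linear extension of v⁻¹ to Ĩ which is the coordinate shift on Ŵ(𝔟). Then the morphism of frames α₂ : 𝓕' → 𝓕_{R'} induced by the projection 𝕎(R) → 𝕎(R') is crystalline, i.e., base change along α₂ is an equivalence from windows over 𝓕' to Dieudonné displays over R'. -/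

import Mathlib

open scoped BigOperators

/-- A frame `(S, I, R, f, f₁)` (with `R = S ⧸ I` implicit):
`S` is a local ring, `I ⊆ S` an ideal, `f` a ring endomorphism of `S`,
`f₁ : I → S` an `f`-linear map such that `f₁(I)` generates `S` as an `S`-module. -/
structure Frame (S : Type) [CommRing S] where
  isLocal : IsLocalRing S
  I : Ideal S
  f : S →+* S
  f₁ : I →ₛₗ[f] S
  span_f₁ : Ideal.span (Set.range ⇑f₁) = ⊤

/-- A window `(P, Q, F, F₁)` over a frame. -/
structure IsWindow {S : Type} [CommRing S] (𝓕 : Frame S)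
    {P : Type} [AddCommGroup P] [Module S P] [Module.Free S P] [Module.Finite S P]
    (Q : Submodule S P) (F : P →ₛₗ[𝓕.f] P) (F₁ : Q →ₛₗ[𝓕.f] P) : Prop where
  smul_le : 𝓕.I • (⊤ : Submodule S P) ≤ Q
  quot_free : ∃ n : ℕ, Nonempty ((P ⧸ Q) ≃ₗ[S] (Fin n → S ⧸ 𝓕.I))
  F₁_smul : ∀ (a : 𝓕.I) (x : P),
    F₁ ⟨(a : S) • x, smul_le (Submodule.smul_mem_smul a.2 Submodule.mem_top)⟩
      = 𝓕.f₁ a • F x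
  span_F₁ : Submodule.span S (Set.range ⇑F₁) = ⊤

/-- A bundled window over a frame. -/
structure Window {S : Type} [CommRing S] (𝓕 : Frame S) where
  P : Type
  [addCommGroup : AddCommGroup P]
  [module : Module S P]
  [free : Module.Free S P]
  [finite : Module.Finite S P]
  Q : Submodule S P
  F : P →ₛₗ[𝓕.f] P
  F₁ : Q →ₛₗ[𝓕.f] P
  isWindow : IsWindow 𝓕 Q F F₁

attribute [instance] Window.addCommGroup Window.module Window.free Window.finite

/-- A morphism of windows over a fixed frame. -/
structure WindowHom {S : Type} [CommRing S] {𝓕 : Frame S} (𝒳 𝒴 : Window 𝓕) where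
  g : 𝒳.P →ₗ[S] 𝒴.P
  mapQ : ∀ x ∈ 𝒳.Q, g x ∈ 𝒴.Q
  commF : ∀ x, 𝒴.F (g x) = g (𝒳.F x)
  commF₁ : ∀ (x : 𝒳.Q) (h : g x ∈ 𝒴.Q), 𝒴.F₁ ⟨g x, h⟩ = g (𝒳.F₁ x)

theorem WindowHom.ext' {S : Type} [CommRing S] {𝓕 : Frame S} {𝒳 𝒴 : Window 𝓕}
    {a b : WindowHom 𝒳 𝒴} (h : a.g = b.g) : a = b := by
  cases a; cases b; cases h; rfl

/-- The identity morphism of windows. -/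
def WindowHom.id' {S : Type} [CommRing S] {𝓕 : Frame S} (𝒳 : Window 𝓕) : WindowHom 𝒳 𝒳 :=
  ⟨LinearMap.id, fun _ h => h, fun _ => rfl, fun x _ => by simp⟩

/-- Composition of morphisms of windows. -/
def WindowHom.comp' {S : Type} [CommRing S] {𝓕 : Frame S} {𝒳₁ 𝒳₂ 𝒳₃ : Window 𝓕}
    (b : WindowHom 𝒳₂ 𝒳₃) (a : WindowHom 𝒳₁ 𝒳₂) : WindowHom 𝒳₁ 𝒳₃ :=
  ⟨b.g.comp a.g, fun x hx => b.mapQ _ (a.mapQ x hx),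
   fun x => by simp [b.commF, a.commF],
   fun x h => by
     have h₂ : a.g x ∈ 𝒳₂.Q := a.mapQ _ x.2
     exact (b.commF₁ ⟨a.g x, h₂⟩ (by simpa using h)).trans
       (congrArg b.g (a.commF₁ x h₂))⟩

instance WindowCategory {S : Type} [CommRing S] (𝓕 : Frame S) :
    CategoryTheory.Category (Window 𝓕) where
  Hom := WindowHom
  id 𝒳 := WindowHom.id' 𝒳
  comp a b := b.comp' a
  id_comp _ := WindowHom.ext' rfl
  comp_id _ := WindowHom.ext' rfl
  assoc _ _ _ := WindowHom.ext' rfl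

/-- An `α`-morphism of windows, for a `u`-morphism of frames with underlying
ring homomorphism `α : S → S'`. -/
structure AlphaHom {S S' : Type} [CommRing S] [CommRing S'] {𝓕 : Frame S} {𝓕' : Frame S'}
    (u : S') (α : S →+* S') (𝒳 : Window 𝓕) (𝒴 : Window 𝓕') where
  g : 𝒳.P →ₛₗ[α] 𝒴.P
  mapQ : ∀ x ∈ 𝒳.Q, g x ∈ 𝒴.Q
  commF : ∀ x, 𝒴.F (g x) = g (𝒳.F x)
  commF₁ : ∀ (x : 𝒳.Q) (h : g x ∈ 𝒴.Q), 𝒴.F₁ ⟨g x, h⟩ = u • g (𝒳.F₁ x)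

/-- A `u`-morphism of frames `α : 𝓕 → 𝓕'`. A morphism of frames is a `1`-morphism. -/
structure IsFrameHom {S S' : Type} [CommRing S] [CommRing S'] (𝓕 : Frame S) (𝓕' : Frame S')
    (u : S') (α : S →+* S') : Prop where
  mapI : ∀ a ∈ 𝓕.I, α a ∈ 𝓕'.I
  commf : ∀ s, 𝓕'.f (α s) = α (𝓕.f s)
  commf₁ : ∀ (a : 𝓕.I) (h : α a ∈ 𝓕'.I), 𝓕'.f₁ ⟨α a, h⟩ = u * α (𝓕.f₁ a)

/-- `α` is crystalline: the base change functor `α_*` (characterized on objects by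
the universal property `Hom_α(𝒳, 𝒵) = Hom_{𝓕'}(α_*𝒳, 𝒵)` via a natural `α`-morphism
`𝒳 → α_*𝒳`) exists and is an equivalence of categories. -/
def IsCrystalline {S S' : Type} [CommRing S] [CommRing S'] (𝓕 : Frame S) (𝓕' : Frame S')
    (u : S') (α : S →+* S') : Prop :=
  ∃ (G : CategoryTheory.Functor (Window 𝓕) (Window 𝓕'))
    (ι : ∀ 𝒳 : Window 𝓕, AlphaHom u α 𝒳 (G.obj 𝒳)),
    (∀ (𝒳₁ 𝒳₂ : Window 𝓕) (h : 𝒳₁ ⟶ 𝒳₂) (x : 𝒳₁.P),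
        (G.map h).g ((ι 𝒳₁).g x) = (ι 𝒳₂).g (h.g x)) ∧
    (∀ (𝒳 : Window 𝓕) (𝒵 : Window 𝓕') (g : AlphaHom u α 𝒳 𝒵),
        ∃! h : G.obj 𝒳 ⟶ 𝒵, ∀ x, h.g ((ι 𝒳).g x) = g.g x) ∧
    G.IsEquivalence

open WittVector in
/-- `x ∈ Ŵ(𝔟)`: all coefficients of the Witt vector `x` lie in `𝔟` and converge to zero
`𝔪`-adically (for every `n`, all but finitely many coefficients lie in `𝔪^n`). -/
def MemHatW (p : ℕ) [Fact p.Prime] {R : Type} [CommRing R] (𝔪 𝔟 : Ideal R)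
    (x : WittVector p R) : Prop :=
  (∀ i, x.coeff i ∈ 𝔟) ∧ ∀ n : ℕ, ∀ᶠ i in Filter.atTop, x.coeff i ∈ 𝔪 ^ n

open WittVector in
/-- `T` is the subring `𝕎(R) ⊆ W(R)`: it is stable under the Frobenius, maps
surjectively onto `W(k)` under the projection (induced by the residue map `ρ : R → k`),
and the kernel of `T → W(k)` is `Ŵ(𝔪)`. -/
def IsSpecialSubring (p : ℕ) [Fact p.Prime] {R k : Type} [CommRing R] [CommRing k]
    (𝔪 : Ideal R) (ρ : R →+* k) (T : Subring (WittVector p R)) : Prop :=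
  (∀ x ∈ T, frobenius x ∈ T) ∧
  (∀ y : WittVector p k, ∃ x ∈ T, WittVector.map ρ x = y) ∧
  (∀ x : WittVector p R, (x ∈ T ∧ WittVector.map ρ x = 0) ↔ MemHatW p 𝔪 𝔪 x)

open Filter Module

section SemilinearAlgebra

theorem Module.Basis.mem_ideal_smul_top_iff {S P ι : Type*} [CommRing S] [AddCommGroup P]
    [Module S P] [Fintype ι] (b : Basis ι S P) (𝔠 : Ideal S) (x : P) :
    x ∈ 𝔠 • (⊤ : Submodule S P) ↔ ∀ i, b.repr x i ∈ 𝔠 := by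
  constructor
  · intro hx i
    refine Submodule.smul_induction_on hx (fun a ha y _ => ?_) (fun y z hy hz => ?_)
    · simpa using 𝔠.mul_mem_right _ ha
    · simpa using 𝔠.add_mem hy hz
  · intro h
    rw [← b.sum_repr x]
    exact Submodule.sum_mem _ fun i _ => Submodule.smul_mem_smul (h i) Submodule.mem_top

/-- A map killing the kernel of a surjective semilinear map descends along it. -/
theorem exists_semilinear_desc {S S' S'' P P' Z : Type*} [CommRing S] [CommRing S'] [CommRing S'']
    [AddCommGroup P] [Module S P] [AddCommGroup P'] [Module S' P'] [AddCommGroup Z] [Module S'' Z]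
    {α : S →+* S'} (hα : Function.Surjective α) {τ : S' →+* S''} (g : P →ₛₗ[α] P')
    (hg : Function.Surjective g) (t : P →+ Z) (ht : ∀ s x, t (s • x) = τ (α s) • t x)
    (hk : ∀ x, g x = 0 → t x = 0) :
    ∃ h : P' →ₛₗ[τ] Z, ∀ x, h (g x) = t x := by
  choose σ hσ using hg
  have key : ∀ x y, g x = g y → t x = t y := fun x y hxy => by
    rw [← sub_eq_zero, ← map_sub]
    exact hk _ (by rw [map_sub, hxy, sub_self])
  refine ⟨⟨⟨fun y => t (σ y), fun y z => ?_⟩, fun s y => ?_⟩, fun x => key _ _ (hσ _)⟩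
  · rw [← map_add]
    exact key _ _ (by simp [hσ])
  · obtain ⟨a, rfl⟩ := hα s
    rw [← ht]
    exact key _ _ (by simp [hσ])

/-- A contracting additive operator on a complete filtered abelian group has a unique fixed point
after translation. -/
theorem existsUnique_eq_add_of_contracting {M : Type*} [AddCommGroup M] (V : ℕ → AddSubgroup M)
    (U : M →+ M) (hU : ∀ k, ∀ x ∈ V k, U x ∈ V k)
    (hnil : ∀ x k, ∀ᶠ n in atTop, U^[n] x ∈ V k)
    (hsep : ∀ x, (∀ k, x ∈ V k) → x = 0)
    (hcomp : ∀ u : ℕ → M, (∀ k, ∀ᶠ n in atTop, u n ∈ V k) →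
      ∃ s, ∀ k, ∀ᶠ n in atTop, s - ∑ i ∈ Finset.range n, u i ∈ V k) (y : M) :
    ∃! x, x = y + U x := by
  obtain ⟨s, hs⟩ := hcomp (fun n => U^[n] y) (hnil y)
  have huniq : ∀ z, z = U z → z = 0 := fun z hz => hsep z fun k => by
    obtain ⟨n, hn⟩ := (hnil z k).exists
    rwa [Function.iterate_fixed hz.symm] at hn
  have hs' : s = y + U s := by
    rw [← sub_eq_zero]
    refine hsep _ fun k => ?_
    obtain ⟨n, hn, hn'⟩ := ((hs k).and ((tendsto_add_atTop_nat 1).eventually (hs k))).exists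
    have h₁ := hU k _ hn
    have h₂ := (V k).sub_mem hn' h₁
    convert h₂ using 1
    rw [Finset.sum_range_succ', map_sub, map_sum]
    simp only [Function.iterate_succ_apply', Function.iterate_zero, id_eq]
    abel
  refine ⟨s, hs', fun x hx => ?_⟩
  rw [← sub_eq_zero]
  refine huniq _ ?_
  rw [map_sub]
  nth_rewrite 1 [hx, hs']
  abel

end SemilinearAlgebra

namespace Frame

variable {S : Type} [CommRing S] (𝓕 : Frame S)

theorem eq_of_f₁_smul_eq {P : Type*} [AddCommGroup P] [Module S P] {u v : P}
    (h : ∀ a : 𝓕.I, 𝓕.f₁ a • u = 𝓕.f₁ a • v) : u = v := by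
  have hle : Ideal.span (Set.range 𝓕.f₁) ≤
      LinearMap.ker (LinearMap.toSpanSingleton S P (u - v)) := by
    rw [Ideal.span_le]
    rintro _ ⟨a, rfl⟩
    simp [smul_sub, h a]
  have h1 : (1 : S) ∈ Ideal.span (Set.range 𝓕.f₁) := by rw [𝓕.span_f₁]; trivial
  simpa [sub_eq_zero] using hle h1

theorem exists_f_eq_mul_f₁ : ∃ θ : S, ∀ a : 𝓕.I, 𝓕.f a = θ * 𝓕.f₁ a := by
  have key : ∀ s ∈ Ideal.span (Set.range 𝓕.f₁), ∃ θ : S, ∀ a : 𝓕.I, s * 𝓕.f a = θ * 𝓕.f₁ a := by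
    intro s hs
    refine Submodule.span_induction ?_ ⟨0, by simp⟩ ?_ ?_ hs
    · rintro _ ⟨b, rfl⟩
      refine ⟨𝓕.f b, fun a => ?_⟩
      have h₁ := 𝓕.f₁.map_smulₛₗ (a : S) b
      have h₂ := 𝓕.f₁.map_smulₛₗ (b : S) a
      have h₃ : (a : S) • b = (b : S) • a := Subtype.ext (mul_comm _ _)
      rw [h₃] at h₁
      rw [mul_comm]
      exact h₁.symm.trans h₂
    · rintro s t _ _ ⟨θ, hθ⟩ ⟨θ', hθ'⟩
      exact ⟨θ + θ', fun a => by rw [add_mul, add_mul, hθ, hθ']⟩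
    · rintro c s _ ⟨θ, hθ⟩
      exact ⟨c * θ, fun a => by rw [smul_eq_mul, mul_assoc, hθ, mul_assoc]⟩
  obtain ⟨θ, hθ⟩ := key 1 (by rw [𝓕.span_f₁]; trivial)
  exact ⟨θ, fun a => by rw [← hθ, one_mul]⟩

/-- The ideal of all `a ∈ I` with `f₁ a ∈ 𝔠`. -/
def preimage (𝔠 : Ideal S) : Ideal S :=
  Submodule.map 𝓕.I.subtype (Submodule.comap 𝓕.f₁ 𝔠)

theorem mem_preimage {𝔠 : Ideal S} {a : S} :
    a ∈ 𝓕.preimage 𝔠 ↔ ∃ h : a ∈ 𝓕.I, 𝓕.f₁ ⟨a, h⟩ ∈ 𝔠 := by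
  simp only [preimage, Submodule.mem_map, Submodule.mem_comap, Submodule.subtype_apply]
  exact ⟨by rintro ⟨x, hx, rfl⟩; exact ⟨x.2, hx⟩, fun ⟨h, h'⟩ => ⟨⟨a, h⟩, h', rfl⟩⟩

theorem preimage_le_I (𝔠 : Ideal S) : 𝓕.preimage 𝔠 ≤ 𝓕.I := fun _ ha =>
  (𝓕.mem_preimage.1 ha).1

end Frame

/-- A basis of `P` adapted to `Q`: the second part of the basis induces a basis of `P ⧸ Q`. -/
theorem IsWindow.exists_adapted_basis {S : Type} [CommRing S] {𝓕 : Frame S} (hne : 𝓕.I ≠ ⊤)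
    {P : Type} [AddCommGroup P] [Module S P] [Module.Free S P] [Module.Finite S P]
    {Q : Submodule S P} {F : P →ₛₗ[𝓕.f] P} {F₁ : Q →ₛₗ[𝓕.f] P} (hW : IsWindow 𝓕 Q F F₁) :
    ∃ (m n : ℕ) (b : Basis (Fin m ⊕ Fin n) S P),
      ∀ x, x ∈ Q ↔ ∀ j, b.repr x (Sum.inr j) ∈ 𝓕.I := by
  have := 𝓕.isLocal
  obtain ⟨n, ⟨e⟩⟩ := hW.quot_free
  let q : P →ₗ[S] (Fin n → S ⧸ 𝓕.I) := e.toLinearMap ∘ₗ Q.mkQ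
  let r : (Fin n → S) →ₗ[S] (Fin n → S ⧸ 𝓕.I) :=
    LinearMap.pi fun j => (Submodule.mkQ 𝓕.I) ∘ₗ LinearMap.proj j
  have hr : Function.Surjective r := fun y => by
    choose x hx using fun j => Submodule.mkQ_surjective 𝓕.I (y j)
    exact ⟨x, funext hx⟩
  have hr0 : ∀ v, r v = 0 ↔ ∀ j, v j ∈ 𝓕.I := fun v => by
    simp [r, funext_iff, Ideal.Quotient.eq_zero_iff_mem]
  obtain ⟨φ, hφ⟩ := Module.projective_lifting_property r q hr
  have hφq : ∀ x, r (φ x) = q x := fun x => LinearMap.congr_fun hφ x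
  have hJ : 𝓕.I ≤ Ideal.jacobson ⊥ := by
    rw [IsLocalRing.jacobson_eq_maximalIdeal ⊥ bot_ne_top]
    exact IsLocalRing.le_maximalIdeal hne
  have hφs : LinearMap.range φ = ⊤ := by
    rw [← top_le_iff]
    refine Submodule.le_of_le_smul_of_le_jacobson_bot (I := 𝓕.I) Module.Finite.fg_top hJ ?_
    intro v _
    obtain ⟨x, hx⟩ := Q.mkQ_surjective (e.symm (r v))
    have hqx : q x = r v := by simp [q, hx]
    have h₁ : v - φ x ∈ 𝓕.I • (⊤ : Submodule S (Fin n → S)) := by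
      rw [(Pi.basisFun S (Fin n)).mem_ideal_smul_top_iff]
      have : r (v - φ x) = 0 := by rw [map_sub, hφq, hqx, sub_self]
      simpa using (hr0 _).1 this
    rw [← add_sub_cancel (φ x) v]
    exact Submodule.add_mem_sup (LinearMap.mem_range_self φ x) h₁
  obtain ⟨s, hs⟩ := Module.projective_lifting_property φ LinearMap.id (LinearMap.range_eq_top.1 hφs)
  have hs' : ∀ v, φ (s v) = v := fun v => LinearMap.congr_fun hs v
  let pr : P →ₗ[S] LinearMap.ker φ :=
    LinearMap.codRestrict _ (LinearMap.id - s ∘ₗ φ) fun x => by simp [hs']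
  have hpr : ∀ x : LinearMap.ker φ, pr x = x := fun x => Subtype.ext (by simp [pr])
  have : Module.Projective S (LinearMap.ker φ) :=
    Module.Projective.of_split (LinearMap.ker φ).subtype pr (LinearMap.ext hpr)
  have : Module.Finite S (LinearMap.ker φ) :=
    Module.Finite.of_surjective pr fun x => ⟨x, hpr x⟩
  have : Module.Free S (LinearMap.ker φ) := Module.free_of_flat_of_isLocalRing
  let E : P ≃ₗ[S] LinearMap.ker φ × (Fin n → S) :=
    LinearEquiv.ofLinearMap (pr.prod φ) ((LinearMap.ker φ).subtype.coprod s)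
      (by
        refine LinearMap.ext fun x => Prod.ext (Subtype.ext ?_) ?_
        · simp [pr, hs']
        · simp [hs'])
      (LinearMap.ext fun x => by simp [pr])
  refine ⟨_, n, ((Module.finBasis S (LinearMap.ker φ)).prod (Pi.basisFun S (Fin n))).map E.symm,
    fun x => ?_⟩
  have h₁ : x ∈ Q ↔ q x = 0 := by simp [q]
  rw [h₁, ← hφq, hr0]
  simp [E]

namespace Window

variable {S : Type} [CommRing S] {𝓕 : Frame S} (𝒳 : Window 𝓕)

open Classical in
/-- The map `F₁`, extended by zero outside `Q`. -/
noncomputable def F₁ext (x : 𝒳.P) : 𝒳.P := if h : x ∈ 𝒳.Q then 𝒳.F₁ ⟨x, h⟩ else 0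

theorem F₁ext_of_mem {x : 𝒳.P} (h : x ∈ 𝒳.Q) : 𝒳.F₁ext x = 𝒳.F₁ ⟨x, h⟩ := dif_pos h

theorem smul_mem_Q {a : S} (ha : a ∈ 𝓕.I) (x : 𝒳.P) : a • x ∈ 𝒳.Q :=
  𝒳.isWindow.smul_le (Submodule.smul_mem_smul ha Submodule.mem_top)

theorem F₁_smul_eq {a : S} (ha : a ∈ 𝓕.I) (x : 𝒳.P) (h : a • x ∈ 𝒳.Q) :
    𝒳.F₁ ⟨a • x, h⟩ = 𝓕.f₁ ⟨a, ha⟩ • 𝒳.F x :=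
  𝒳.isWindow.F₁_smul ⟨a, ha⟩ x

theorem F₁ext_smul {a : S} (ha : a ∈ 𝓕.I) (x : 𝒳.P) :
    𝒳.F₁ext (a • x) = 𝓕.f₁ ⟨a, ha⟩ • 𝒳.F x :=
  (𝒳.F₁ext_of_mem (𝒳.smul_mem_Q ha x)).trans (𝒳.F₁_smul_eq ha x _)

/-- The semilinear operator of a normal decomposition: `F₁` on the first part, `F` on the
second part. -/
noncomputable def op {m n : ℕ} : Fin m ⊕ Fin n → 𝒳.P → 𝒳.P :=
  Sum.elim (fun _ => 𝒳.F₁ext) (fun _ => 𝒳.F)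

theorem F₁ext_mem {𝔠 : Ideal S} {x : 𝒳.P}
    (hx : x ∈ 𝓕.preimage 𝔠 • (⊤ : Submodule S 𝒳.P)) : 𝒳.F₁ext x ∈ 𝔠 • (⊤ : Submodule S 𝒳.P) := by
  have hQ : 𝓕.preimage 𝔠 • (⊤ : Submodule S 𝒳.P) ≤ 𝒳.Q :=
    (Submodule.smul_mono_left (𝓕.preimage_le_I 𝔠)).trans 𝒳.isWindow.smul_le
  refine Submodule.smul_induction_on' hx (fun a ha y _ => ?_) (fun y hy z hz hy' hz' => ?_)
  · obtain ⟨h, h'⟩ := 𝓕.mem_preimage.1 ha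
    rw [𝒳.F₁ext_of_mem (𝒳.smul_mem_Q h y), 𝒳.F₁_smul_eq h]
    exact Submodule.smul_mem_smul h' Submodule.mem_top
  · rw [𝒳.F₁ext_of_mem (hQ hy)] at hy'
    rw [𝒳.F₁ext_of_mem (hQ hz)] at hz'
    rw [𝒳.F₁ext_of_mem (𝒳.Q.add_mem (hQ hy) (hQ hz))]
    have := 𝒳.F₁.map_add ⟨y, hQ hy⟩ ⟨z, hQ hz⟩
    exact this ▸ Submodule.add_mem _ hy' hz'

theorem F_mem {𝔠 : Ideal S} {x : 𝒳.P}
    (hx : x ∈ 𝓕.preimage 𝔠 • (⊤ : Submodule S 𝒳.P)) : 𝒳.F x ∈ 𝔠 • (⊤ : Submodule S 𝒳.P) := by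
  obtain ⟨θ, hθ⟩ := 𝓕.exists_f_eq_mul_f₁
  refine Submodule.smul_induction_on' hx (fun a ha y _ => ?_) (fun y hy z hz hy' hz' => ?_)
  · obtain ⟨h, h'⟩ := 𝓕.mem_preimage.1 ha
    rw [LinearMap.map_smulₛₗ, hθ ⟨a, h⟩]
    exact Submodule.smul_mem_smul (𝔠.mul_mem_left _ h') Submodule.mem_top
  · rw [map_add]
    exact Submodule.add_mem _ hy' hz'

variable {m n : ℕ}

theorem op_mem {𝔠 : Ideal S} {x : 𝒳.P} (i : Fin m ⊕ Fin n)
    (hx : x ∈ 𝓕.preimage 𝔠 • (⊤ : Submodule S 𝒳.P)) : 𝒳.op i x ∈ 𝔠 • (⊤ : Submodule S 𝒳.P) := by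
  cases i
  · exact 𝒳.F₁ext_mem hx
  · exact 𝒳.F_mem hx

theorem op_add (i : Fin m ⊕ Fin n) {x y : 𝒳.P} (hx : i.isLeft → x ∈ 𝒳.Q)
    (hy : i.isLeft → y ∈ 𝒳.Q) : 𝒳.op i (x + y) = 𝒳.op i x + 𝒳.op i y := by
  cases i with
  | inl i =>
    replace hx := hx rfl
    replace hy := hy rfl
    simp only [op, Sum.elim_inl]
    rw [𝒳.F₁ext_of_mem hx, 𝒳.F₁ext_of_mem hy, 𝒳.F₁ext_of_mem (𝒳.Q.add_mem hx hy), ← map_add]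
    rfl
  | inr j => exact map_add _ _ _

section AdaptedBasis

variable {𝒳} {b : Basis (Fin m ⊕ Fin n) S 𝒳.P}

theorem basis_inl_mem_Q (hb : ∀ x, x ∈ 𝒳.Q ↔ ∀ j, b.repr x (Sum.inr j) ∈ 𝓕.I) (i : Fin m) :
    b (Sum.inl i) ∈ 𝒳.Q := (hb _).2 fun j => by simp

theorem eq_sum_of_mem_Q (hb : ∀ x, x ∈ 𝒳.Q ↔ ∀ j, b.repr x (Sum.inr j) ∈ 𝓕.I)
    (x : 𝒳.Q) :
    x = (∑ i, b.repr (x : 𝒳.P) (Sum.inl i) •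
        (⟨b (Sum.inl i), basis_inl_mem_Q hb i⟩ : 𝒳.Q)) +
      ∑ j, (⟨b.repr (x : 𝒳.P) (Sum.inr j) • b (Sum.inr j),
        𝒳.smul_mem_Q ((hb _).1 x.2 j) _⟩ : 𝒳.Q) := by
  refine Subtype.ext ?_
  conv_lhs => rw [← b.sum_repr (x : 𝒳.P), Fintype.sum_sum_type]
  simp

/-- The value of `F₁` in terms of an adapted basis. -/
theorem F₁_eq_sum (hb : ∀ x, x ∈ 𝒳.Q ↔ ∀ j, b.repr x (Sum.inr j) ∈ 𝓕.I) (x : 𝒳.Q) :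
    𝒳.F₁ x = (∑ i, 𝓕.f (b.repr (x : 𝒳.P) (Sum.inl i)) • 𝒳.op (Sum.inl i : Fin m ⊕ Fin n)
        (b (Sum.inl i))) +
      ∑ j, 𝓕.f₁ ⟨b.repr (x : 𝒳.P) (Sum.inr j), (hb _).1 x.2 j⟩ •
        𝒳.op (Sum.inr j : Fin m ⊕ Fin n) (b (Sum.inr j)) := by
  conv_lhs => rw [eq_sum_of_mem_Q hb x, map_add, map_sum, map_sum]
  congr 1
  · refine Finset.sum_congr rfl fun i _ => ?_
    rw [LinearMap.map_smulₛₗ]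
    simp [op, 𝒳.F₁ext_of_mem (basis_inl_mem_Q hb i)]
  · refine Finset.sum_congr rfl fun j _ => ?_
    rw [𝒳.F₁_smul_eq ((hb _).1 x.2 j)]
    rfl

theorem span_op_eq_top (hb : ∀ x, x ∈ 𝒳.Q ↔ ∀ j, b.repr x (Sum.inr j) ∈ 𝓕.I) :
    Submodule.span S (Set.range fun i => 𝒳.op i (b i)) = ⊤ := by
  rw [← top_le_iff, ← 𝒳.isWindow.span_F₁, Submodule.span_le]
  rintro _ ⟨x, rfl⟩
  rw [F₁_eq_sum hb x]
  exact Submodule.add_mem _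
    (Submodule.sum_mem _ fun i _ => Submodule.smul_mem _ _ (Submodule.subset_span ⟨Sum.inl i, rfl⟩))
    (Submodule.sum_mem _ fun j _ => Submodule.smul_mem _ _ (Submodule.subset_span ⟨Sum.inr j, rfl⟩))

/-- The linearization of the operator of a normal decomposition is bijective. -/
theorem exists_linearEquiv_op (hb : ∀ x, x ∈ 𝒳.Q ↔ ∀ j, b.repr x (Sum.inr j) ∈ 𝓕.I) :
    ∃ e : 𝒳.P ≃ₗ[S] 𝒳.P, ∀ i, e (b i) = 𝒳.op i (b i) := by
  have hs : Function.Surjective (b.constr S fun i => 𝒳.op i (b i)) := by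
    rw [← LinearMap.range_eq_top, Basis.constr_range, span_op_eq_top hb]
  exact ⟨LinearEquiv.ofBijective _ (OrzechProperty.bijective_of_surjective_endomorphism _ hs),
    fun i => by simp⟩

end AdaptedBasis

end Window

section WindowHom

variable {S : Type} [CommRing S] {𝓕 : Frame S} {𝒳 𝒴 : Window 𝓕}

/-- Compatibility with `F` follows from compatibility with `F₁`. -/
theorem Window.commF_of_commF₁ (h : 𝒳.P →ₗ[S] 𝒴.P)
    (hF₁ : ∀ x ∈ 𝒳.Q, 𝒴.F₁ext (h x) = h (𝒳.F₁ext x)) (x : 𝒳.P) :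
    𝒴.F (h x) = h (𝒳.F x) := by
  refine 𝓕.eq_of_f₁_smul_eq fun a => ?_
  have h₁ := hF₁ _ (𝒳.smul_mem_Q a.2 x)
  rwa [𝒳.F₁ext_smul a.2, map_smul, map_smul, 𝒴.F₁ext_smul a.2] at h₁

variable {m n : ℕ} {b : Basis (Fin m ⊕ Fin n) S 𝒳.P}

/-- A linear map respecting `Q` is a morphism of windows if it commutes with the operators of a
normal decomposition on an adapted basis. -/
theorem Window.commF₁_of_op (hb : ∀ x, x ∈ 𝒳.Q ↔ ∀ j, b.repr x (Sum.inr j) ∈ 𝓕.I)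
    (h : 𝒳.P →ₗ[S] 𝒴.P) (hQ : ∀ x ∈ 𝒳.Q, h x ∈ 𝒴.Q)
    (hop : ∀ i, h (𝒳.op i (b i)) = 𝒴.op i (h (b i))) :
    ∀ x ∈ 𝒳.Q, 𝒴.F₁ext (h x) = h (𝒳.F₁ext x) := by
  intro x hx
  let Φ : 𝒳.Q →ₗ[S] 𝒴.Q := h.restrict hQ
  have hΦ : ∀ y : 𝒳.Q, 𝒴.F₁ (Φ y) = 𝒴.F₁ext (h y) := fun y =>
    (𝒴.F₁ext_of_mem (hQ y y.2)).symm
  rw [𝒳.F₁ext_of_mem hx, Window.F₁_eq_sum hb, ← hΦ ⟨x, hx⟩]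
  conv_lhs => rw [Window.eq_sum_of_mem_Q hb ⟨x, hx⟩]
  simp only [map_add, map_sum, map_smul, hop, LinearMap.map_smulₛₗ, hΦ]
  congr 1
  refine Finset.sum_congr rfl fun j _ => ?_
  rw [𝒴.F₁ext_smul ((hb x).1 hx j)]
  rfl

/-- Construct a morphism of windows from a linear map commuting with `F₁`. -/
def WindowHom.ofF₁ext (h : 𝒳.P →ₗ[S] 𝒴.P) (hQ : ∀ x ∈ 𝒳.Q, h x ∈ 𝒴.Q)
    (hF₁ : ∀ x ∈ 𝒳.Q, 𝒴.F₁ext (h x) = h (𝒳.F₁ext x)) : WindowHom 𝒳 𝒴 where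
  g := h
  mapQ := hQ
  commF := Window.commF_of_commF₁ h hF₁
  commF₁ x hx := by
    rw [← 𝒴.F₁ext_of_mem hx, hF₁ _ x.2, 𝒳.F₁ext_of_mem x.2]

theorem WindowHom.op_apply (h : WindowHom 𝒳 𝒴) (i : Fin m ⊕ Fin n) {x : 𝒳.P}
    (hx : i.isLeft → x ∈ 𝒳.Q) : h.g (𝒳.op i x) = 𝒴.op i (h.g x) := by
  cases i with
  | inl i =>
    have hx := hx rfl
    have := h.commF₁ ⟨x, hx⟩ (h.mapQ x hx)
    simpa [Window.op, 𝒳.F₁ext_of_mem hx, 𝒴.F₁ext_of_mem (h.mapQ x hx)] using this.symm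
  | inr j => exact (h.commF x).symm

end WindowHom

/-- A filtration `J` of an ideal `𝔞`, contained in `I` and stable under `f₁`, for which `𝔞` is
complete and `f₁` is topologically nilpotent. -/
structure Frame.IsContracting {S : Type} [CommRing S] (𝓕 : Frame S) (𝔞 : Ideal S)
    (J : ℕ → Ideal S) : Prop where
  le_preimage : 𝔞 ≤ 𝓕.preimage 𝔞
  stable : ∀ k, J k ≤ 𝓕.preimage (J k)
  nilpotent : ∀ k, ∀ a ∈ 𝔞, ∀ᶠ n in atTop, a ∈ 𝓕.preimage^[n] (J k)
  separated : ∀ a, (∀ k, a ∈ J k) → a = 0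
  complete : ∀ u : ℕ → S, (∀ n, u n ∈ 𝔞) → (∀ k, ∀ᶠ n in atTop, u n ∈ J k) →
    ∃ s ∈ 𝔞, ∀ k, ∀ᶠ n in atTop, s - ∑ i ∈ Finset.range n, u i ∈ J k

/-- The fixed point equation that controls lifts of homomorphisms of windows along a
contracting ideal. -/
theorem Frame.IsContracting.existsUnique_linearMap {S : Type} [CommRing S] {𝓕 : Frame S}
    {𝔞 : Ideal S} {J : ℕ → Ideal S} (hJ : 𝓕.IsContracting 𝔞 J) {𝒳 𝒴 : Window 𝓕} {m n : ℕ}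
    {b : Basis (Fin m ⊕ Fin n) S 𝒳.P} (hb : ∀ x, x ∈ 𝒳.Q ↔ ∀ j, b.repr x (Sum.inr j) ∈ 𝓕.I)
    (c : Fin m ⊕ Fin n → (𝔞 • ⊤ : Submodule S 𝒴.P)) :
    ∃! ω : 𝒳.P →ₗ[S] (𝔞 • ⊤ : Submodule S 𝒴.P),
      ∀ i, (ω (𝒳.op i (b i)) : 𝒴.P) = c i + 𝒴.op i (ω (b i)) := by
  have := 𝓕.isLocal
  obtain ⟨e, he⟩ := Window.exists_linearEquiv_op hb
  let y := Module.finBasis S 𝒴.P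
  let N : Submodule S 𝒴.P := 𝔞 • ⊤
  have hNpre : N ≤ 𝓕.preimage 𝔞 • ⊤ := Submodule.smul_mono_left hJ.le_preimage
  have hNQ : N ≤ 𝒴.Q :=
    (hNpre.trans (Submodule.smul_mono_left (𝓕.preimage_le_I 𝔞))).trans 𝒴.isWindow.smul_le
  let opN : Fin m ⊕ Fin n → N →+ N := fun i =>
    AddMonoidHom.mk' (fun x => ⟨𝒴.op i x, 𝒴.op_mem i (hNpre x.2)⟩) fun x x' => Subtype.ext
      (𝒴.op_add i (fun _ => hNQ x.2) fun _ => hNQ x'.2)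
  let U : (𝒳.P →ₗ[S] N) →+ (𝒳.P →ₗ[S] N) :=
    AddMonoidHom.mk' (fun ω => (b.constr S fun i => opN i (ω (b i))) ∘ₗ e.symm.toLinearMap)
      fun ω ω' => by
        rw [← LinearMap.add_comp]
        congr 1
        exact b.ext fun i => by simp only [LinearMap.add_apply, Basis.constr_basis, map_add]
  have hU : ∀ ω i, U ω (𝒳.op i (b i)) = opN i (ω (b i)) := fun ω i => by
    simp [U, ← he]
  have hext : ∀ ω ω' : 𝒳.P →ₗ[S] N, (∀ i, ω (𝒳.op i (b i)) = ω' (𝒳.op i (b i))) → ω = ω' :=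
    fun ω ω' h => by
      have : ω ∘ₗ e.toLinearMap = ω' ∘ₗ e.toLinearMap := b.ext fun i => by simp [he, h]
      ext x
      simpa using congrArg Subtype.val (LinearMap.congr_fun this (e.symm x))
  let V : Ideal S → AddSubgroup (𝒳.P →ₗ[S] N) := fun 𝔠 =>
    { carrier := {ω | ∀ x, (ω x : 𝒴.P) ∈ 𝔠 • (⊤ : Submodule S 𝒴.P)}
      zero_mem' := fun x => by simp
      add_mem' := fun h h' x => by simpa using Submodule.add_mem _ (h x) (h' x)
      neg_mem' := fun h x => by simpa using h x }
  have hVspan : ∀ 𝔠 ω (v : Fin m ⊕ Fin n → 𝒳.P), Submodule.span S (Set.range v) = ⊤ →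
      (∀ i, (ω (v i) : 𝒴.P) ∈ 𝔠 • (⊤ : Submodule S 𝒴.P)) → ω ∈ V 𝔠 := fun 𝔠 ω v hv h x => by
    have : Submodule.span S (Set.range v) ≤
        (𝔠 • (⊤ : Submodule S 𝒴.P)).comap (N.subtype ∘ₗ ω) := by
      rw [Submodule.span_le]
      rintro _ ⟨i, rfl⟩
      exact h i
    exact this (hv ▸ Submodule.mem_top)
  have hVb : ∀ 𝔠 ω, ω ∈ V 𝔠 ↔ ∀ i j, y.repr (ω (b i)) j ∈ 𝔠 := fun 𝔠 ω =>
    ⟨fun h i => (y.mem_ideal_smul_top_iff 𝔠 _).1 (h _), fun h =>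
      hVspan 𝔠 ω b b.span_eq fun i => (y.mem_ideal_smul_top_iff 𝔠 _).2 (h i)⟩
  have hUV : ∀ 𝔠, ∀ ω ∈ V (𝓕.preimage 𝔠), U ω ∈ V 𝔠 := fun 𝔠 ω hω =>
    hVspan 𝔠 _ _ (Window.span_op_eq_top hb) fun i => by
      rw [hU]
      exact 𝒴.op_mem i (hω _)
  have hVmono : Monotone V := fun _ _ h _ hω x => Submodule.smul_mono_left h (hω x)
  have hiter : ∀ n 𝔠, ∀ ω ∈ V (𝓕.preimage^[n] 𝔠), U^[n] ω ∈ V 𝔠 := by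
    intro n
    induction n with
    | zero => exact fun _ _ h => h
    | succ n ih =>
      intro 𝔠 ω hω
      rw [Function.iterate_succ_apply]
      rw [Function.iterate_succ_apply'] at hω
      exact ih _ _ (hUV _ _ hω)
  obtain ⟨ω, hω, huniq⟩ := existsUnique_eq_add_of_contracting (fun k => V (J k)) U
    (fun k ω hω => hUV _ _ (hVmono (hJ.stable k) hω))
    (fun ω k => by
      have h₁ : ∀ᶠ n in atTop, ∀ i j, y.repr (ω (b i)) j ∈ 𝓕.preimage^[n] (J k) := by
        rw [eventually_all]
        intro i
        rw [eventually_all]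
        exact fun j => hJ.nilpotent k _ ((y.mem_ideal_smul_top_iff 𝔞 _).1 (ω (b i)).2 j)
      exact h₁.mono fun n hn => hiter n _ _ ((hVb _ _).2 hn))
    (fun ω hω => b.ext fun i => Subtype.ext <| y.ext_elem fun j => by
      simpa using hJ.separated _ fun k => (hVb _ _).1 (hω k) i j)
    (fun u hu => by
      choose s hs hs' using fun i j => hJ.complete (fun n => y.repr (u n (b i)) j)
        (fun n => (y.mem_ideal_smul_top_iff 𝔞 _).1 (u n (b i)).2 j)
        (fun k => (hu k).mono fun n hn => (hVb _ _).1 hn i j)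
      have hw : ∀ i, ∃ w : N, ∀ j, y.repr w j = s i j := fun i =>
        ⟨⟨∑ j, s i j • y j, Submodule.sum_mem _ fun j _ =>
          Submodule.smul_mem_smul (hs i j) Submodule.mem_top⟩, fun j => by rw [y.repr_sum_self]⟩
      choose w hw using hw
      refine ⟨b.constr S w, fun k => ?_⟩
      have h₁ := eventually_all.2 fun i => eventually_all.2 fun j => hs' i j k
      refine h₁.mono fun n hn => (hVb _ _).2 fun i j => ?_
      simpa [Basis.constr_basis, hw] using hn i j)
    (b.constr S c ∘ₗ e.symm.toLinearMap)
  have hc : ∀ i, (b.constr S c ∘ₗ e.symm.toLinearMap) (𝒳.op i (b i)) = c i := fun i => by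
    simp [← he]
  refine ⟨ω, fun i => ?_, fun ω' hω' => huniq _ (hext _ _ fun i => ?_)⟩
  · conv_lhs => rw [hω, LinearMap.add_apply, hc, hU]
    rfl
  · rw [LinearMap.add_apply, hc, hU]
    exact Subtype.ext (hω' i)

section FrameHom

variable {S S' : Type} [CommRing S] [CommRing S'] {𝓕 : Frame S} {𝓕' : Frame S'} {α : S →+* S'}

/-- A surjective homomorphism of frames for which `I` is the inverse image of `I'`. -/
structure IsSurjectiveFrameHom (𝓕 : Frame S) (𝓕' : Frame S') (α : S →+* S') : Prop
    extends IsFrameHom 𝓕 𝓕' 1 α where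
  surjective : Function.Surjective α
  mem_I : ∀ a, α a ∈ 𝓕'.I → a ∈ 𝓕.I
  I_ne_top : 𝓕'.I ≠ ⊤

theorem IsSurjectiveFrameHom.f₁_apply (hα : IsSurjectiveFrameHom 𝓕 𝓕' α) {a : S} (ha : a ∈ 𝓕.I) :
    𝓕'.f₁ ⟨α a, hα.mapI a ha⟩ = α (𝓕.f₁ ⟨a, ha⟩) :=
  (hα.commf₁ ⟨a, ha⟩ _).trans (one_mul _)

theorem IsSurjectiveFrameHom.I_ne_top_source (hα : IsSurjectiveFrameHom 𝓕 𝓕' α) : 𝓕.I ≠ ⊤ := by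
  rw [Ideal.ne_top_iff_one]
  intro h
  exact (Ideal.ne_top_iff_one _).1 hα.I_ne_top (by simpa using hα.mapI _ h)

theorem IsSurjectiveFrameHom.ker_le_I (hα : IsSurjectiveFrameHom 𝓕 𝓕' α) :
    RingHom.ker α ≤ 𝓕.I := fun a ha => hα.mem_I a (by rw [RingHom.mem_ker.1 ha]; exact zero_mem _)

theorem IsSurjectiveFrameHom.ker_le_preimage (hα : IsSurjectiveFrameHom 𝓕 𝓕' α) :
    RingHom.ker α ≤ 𝓕.preimage (RingHom.ker α) := fun a ha => by
  refine 𝓕.mem_preimage.2 ⟨hα.ker_le_I ha, ?_⟩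
  rw [RingHom.mem_ker, ← hα.f₁_apply]
  simp only [RingHom.mem_ker.1 ha]
  exact map_zero 𝓕'.f₁

namespace AlphaHom

variable {𝒳 𝒴 : Window 𝓕} {𝒵 : Window 𝓕'}

theorem F₁ext_apply (g : AlphaHom 1 α 𝒳 𝒵) {x : 𝒳.P} (hx : x ∈ 𝒳.Q) :
    g.g (𝒳.F₁ext x) = 𝒵.F₁ext (g.g x) := by
  have := g.commF₁ ⟨x, hx⟩ (g.mapQ x hx)
  rw [𝒳.F₁ext_of_mem hx, 𝒵.F₁ext_of_mem (g.mapQ x hx), this, one_smul]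

theorem op_apply {m n : ℕ} (g : AlphaHom 1 α 𝒳 𝒵) (i : Fin m ⊕ Fin n) {x : 𝒳.P}
    (hx : i.isLeft → x ∈ 𝒳.Q) : g.g (𝒳.op i x) = 𝒵.op i (g.g x) := by
  cases i with
  | inl i => exact g.F₁ext_apply (hx rfl)
  | inr j => exact (g.commF x).symm

/-- Composition of an `α`-homomorphism with a homomorphism of windows. -/
def comp {𝒵' : Window 𝓕'} (h : WindowHom 𝒵 𝒵') (g : AlphaHom 1 α 𝒳 𝒵) : AlphaHom 1 α 𝒳 𝒵' where
  g := h.g.comp g.g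
  mapQ x hx := h.mapQ _ (g.mapQ x hx)
  commF x := by simp [h.commF, g.commF]
  commF₁ x hx := by
    have h₁ := h.commF₁ ⟨g.g x, g.mapQ _ x.2⟩ hx
    rw [g.commF₁ x (g.mapQ _ x.2)] at h₁
    simpa using h₁

/-- Composition of a homomorphism of windows with an `α`-homomorphism. -/
def precomp (g : AlphaHom 1 α 𝒴 𝒵) (h : WindowHom 𝒳 𝒴) : AlphaHom 1 α 𝒳 𝒵 where
  g := g.g.comp h.g
  mapQ x hx := g.mapQ _ (h.mapQ x hx)
  commF x := by simp [h.commF, g.commF]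
  commF₁ x hx := by
    have h₁ := g.commF₁ ⟨h.g x, h.mapQ _ x.2⟩ hx
    rw [h.commF₁ x (h.mapQ _ x.2)] at h₁
    simpa using h₁

/-- Construct an `α`-homomorphism from a semilinear map commuting with `F₁`. -/
def ofF₁ext (hα : IsSurjectiveFrameHom 𝓕 𝓕' α) (g : 𝒳.P →ₛₗ[α] 𝒵.P)
    (hQ : ∀ x ∈ 𝒳.Q, g x ∈ 𝒵.Q) (hF₁ : ∀ x ∈ 𝒳.Q, 𝒵.F₁ext (g x) = g (𝒳.F₁ext x)) :
    AlphaHom 1 α 𝒳 𝒵 where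
  g := g
  mapQ := hQ
  commF x := by
    refine 𝓕'.eq_of_f₁_smul_eq fun a => ?_
    obtain ⟨a, ha⟩ := a
    obtain ⟨a, rfl⟩ := hα.surjective a
    have ha' := hα.mem_I a ha
    have h₁ := hF₁ _ (𝒳.smul_mem_Q ha' x)
    rwa [𝒳.F₁ext_smul ha', LinearMap.map_smulₛₗ, LinearMap.map_smulₛₗ, 𝒵.F₁ext_smul ha,
      ← hα.f₁_apply] at h₁
  commF₁ x hx := by
    rw [← 𝒵.F₁ext_of_mem hx, hF₁ _ x.2, 𝒳.F₁ext_of_mem x.2, one_smul]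

/-- An `α`-homomorphism that identifies its target with the base change of its source. -/
structure IsBaseChange (g : AlphaHom 1 α 𝒳 𝒵) : Prop where
  surjective : Function.Surjective g.g
  mem_of_eq_zero : ∀ x, g.g x = 0 → x ∈ RingHom.ker α • (⊤ : Submodule S 𝒳.P)
  mem_Q : ∀ x, g.g x ∈ 𝒵.Q → x ∈ 𝒳.Q

/-- The universal property of base change. -/
theorem IsBaseChange.existsUnique_desc {𝒵' : Window 𝓕'} {g : AlphaHom 1 α 𝒳 𝒵}
    (hα : Function.Surjective α) (hg : g.IsBaseChange) (t : AlphaHom 1 α 𝒳 𝒵') :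
    ∃! h : WindowHom 𝒵 𝒵', ∀ x, h.g (g.g x) = t.g x := by
  have hk : ∀ x, g.g x = 0 → t.g x = 0 := fun x hx => by
    refine Submodule.smul_induction_on (hg.mem_of_eq_zero x hx) (fun a ha y _ => ?_)
      (fun y z hy hz => ?_)
    · rw [LinearMap.map_smulₛₗ, RingHom.mem_ker.1 ha, zero_smul]
    · rw [map_add, hy, hz, add_zero]
  obtain ⟨h, hh⟩ := exists_semilinear_desc (τ := RingHom.id S') hα g.g hg.surjective
    t.g.toAddMonoidHom (fun s x => by simp) hk
  replace hh : ∀ x, h (g.g x) = t.g x := hh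
  have hQ : ∀ x ∈ 𝒵.Q, h x ∈ 𝒵'.Q := fun x hx => by
    obtain ⟨x, rfl⟩ := hg.surjective x
    rw [hh]
    exact t.mapQ _ (hg.mem_Q _ hx)
  refine ⟨WindowHom.ofF₁ext h hQ fun x hx => ?_, hh, fun h' hh' => WindowHom.ext' ?_⟩
  · obtain ⟨x, rfl⟩ := hg.surjective x
    have hx := hg.mem_Q _ hx
    rw [hh, ← t.F₁ext_apply hx, ← g.F₁ext_apply hx, hh]
  · ext x
    obtain ⟨x, rfl⟩ := hg.surjective x
    exact (hh' x).trans (hh x).symm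

/-- Homomorphisms of windows lift uniquely along a base change with contracting kernel. -/
theorem IsBaseChange.existsUnique_lift {J : ℕ → Ideal S} (hα : IsSurjectiveFrameHom 𝓕 𝓕' α)
    (hJ : 𝓕.IsContracting (RingHom.ker α) J) {g : AlphaHom 1 α 𝒴 𝒵} (hg : g.IsBaseChange)
    (t : AlphaHom 1 α 𝒳 𝒵) : ∃! h : WindowHom 𝒳 𝒴, ∀ x, g.g (h.g x) = t.g x := by
  obtain ⟨m, n, b, hb⟩ := 𝒳.isWindow.exists_adapted_basis hα.I_ne_top_source
  let N : Submodule S 𝒴.P := RingHom.ker α • ⊤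
  have hgN : ∀ x ∈ N, g.g x = 0 := fun x hx => by
    refine Submodule.smul_induction_on hx (fun a ha y _ => ?_) (fun y z hy hz => ?_)
    · rw [LinearMap.map_smulₛₗ, RingHom.mem_ker.1 ha, zero_smul]
    · rw [map_add, hy, hz, add_zero]
  have hNQ : N ≤ 𝒴.Q := fun x hx => hg.mem_Q _ (by rw [hgN x hx]; exact zero_mem _)
  choose v hv using fun i => hg.surjective (t.g (b i))
  let h₀ : 𝒳.P →ₗ[S] 𝒴.P := b.constr S v
  have hlift : ∀ h : 𝒳.P →ₗ[S] 𝒴.P, (∀ i, g.g (h (b i)) = t.g (b i)) →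
      ∀ x, g.g (h x) = t.g x := fun h hh x => by
    conv_lhs => rw [← b.sum_repr x]
    conv_rhs => rw [← b.sum_repr x]
    simp only [map_sum, LinearMap.map_smulₛₗ, RingHom.id_apply, hh]
  have hh₀ : ∀ x, g.g (h₀ x) = t.g x := hlift h₀ fun i => by simp [h₀, hv]
  have hQ : ∀ h : 𝒳.P →ₗ[S] 𝒴.P, (∀ x, g.g (h x) = t.g x) → ∀ x ∈ 𝒳.Q, h x ∈ 𝒴.Q :=
    fun h hh x hx => hg.mem_Q _ (by rw [hh]; exact t.mapQ x hx)
  have hbQ : ∀ i : Fin m ⊕ Fin n, i.isLeft → b i ∈ 𝒳.Q := fun i hi => by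
    cases i with
    | inl i => exact Window.basis_inl_mem_Q hb i
    | inr j => cases hi
  have hc : ∀ i, 𝒴.op i (h₀ (b i)) - h₀ (𝒳.op i (b i)) ∈ N := fun i =>
    hg.mem_of_eq_zero _ (by
      rw [map_sub, hh₀, g.op_apply i fun hi => hQ _ hh₀ _ (hbQ i hi), hh₀, t.op_apply i (hbQ i),
        sub_self])
  obtain ⟨ω, hω, huniq⟩ := hJ.existsUnique_linearMap (𝒴 := 𝒴) hb fun i => ⟨_, hc i⟩
  have hop : ∀ (ω : 𝒳.P →ₗ[S] N) (i : Fin m ⊕ Fin n),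
      𝒴.op i (h₀ (b i) + ω (b i)) = 𝒴.op i (h₀ (b i)) + 𝒴.op i (ω (b i)) := fun ω i =>
    𝒴.op_add i (fun hi => hQ _ hh₀ _ (hbQ i hi)) fun _ => hNQ (ω (b i)).2
  let h : 𝒳.P →ₗ[S] 𝒴.P := h₀ + N.subtype ∘ₗ ω
  have hh : ∀ x, g.g (h x) = t.g x := fun x => by
    simp [h, hh₀, hgN _ (ω x).2]
  refine ⟨WindowHom.ofF₁ext h (hQ h hh) (Window.commF₁_of_op hb h (hQ h hh) fun i => ?_), hh,
    fun h' hh' => WindowHom.ext' ?_⟩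
  · change h₀ _ + (ω _ : 𝒴.P) = 𝒴.op i (h₀ _ + (ω _ : 𝒴.P))
    rw [hop, hω]
    simp only
    abel
  · replace hh' : ∀ x, g.g (h'.g x) = t.g x := hh'
    let ω' : 𝒳.P →ₗ[S] N := LinearMap.codRestrict N (h'.g - h₀) fun x =>
      hg.mem_of_eq_zero _ (by simp [hh₀, hh'])
    have hω' : ∀ x, (ω' x : 𝒴.P) = h'.g x - h₀ x := fun x => rfl
    have h₁ : ω' = ω := huniq ω' fun i => by
      have h₂ := hop ω' i
      have h₃ := h'.op_apply i (hbQ i)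
      rw [hω', add_sub_cancel, ← hω', ← h₃] at h₂
      rw [hω', h₂]
      exact add_sub_right_comm _ _ _
    ext x
    change _ = h₀ x + (ω x : 𝒴.P)
    rw [← h₁, hω', add_sub_cancel]

/-- Every window has a base change along a surjective homomorphism of frames. -/
theorem exists_isBaseChange (hα : IsSurjectiveFrameHom 𝓕 𝓕' α) (𝒳 : Window 𝓕) :
    ∃ (𝒵 : Window 𝓕') (g : AlphaHom 1 α 𝒳 𝒵), g.IsBaseChange := by
  obtain ⟨m, n, b, hb⟩ := 𝒳.isWindow.exists_adapted_basis hα.I_ne_top_source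
  let g : 𝒳.P →ₛₗ[α] (Fin m ⊕ Fin n → S') :=
    { toFun := fun x i => α (b.repr x i)
      map_add' := fun x y => by ext; simp
      map_smul' := fun s x => by ext; simp }
  have hg : Function.Surjective g := fun y => by
    choose z hz using fun i => hα.surjective (y i)
    exact ⟨b.equivFun.symm z, funext fun i => by
      simp only [g, LinearMap.coe_mk, AddHom.coe_mk, ← Basis.equivFun_apply,
        LinearEquiv.apply_symm_apply, hz]⟩
  have hg0 : ∀ x, g x = 0 → x ∈ RingHom.ker α • (⊤ : Submodule S 𝒳.P) := fun x hx =>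
    (b.mem_ideal_smul_top_iff _ _).2 fun i => congrFun hx i
  let Q : Submodule S' (Fin m ⊕ Fin n → S') :=
    { carrier := {y | ∀ j, y (Sum.inr j) ∈ 𝓕'.I}
      add_mem' := fun h h' j => 𝓕'.I.add_mem (h j) (h' j)
      zero_mem' := fun j => 𝓕'.I.zero_mem
      smul_mem' := fun s y h j => 𝓕'.I.mul_mem_left s (h j) }
  have hgQ : ∀ x, g x ∈ Q ↔ x ∈ 𝒳.Q := fun x => by
    rw [hb]
    exact ⟨fun h j => hα.mem_I _ (h j), fun h j => hα.mapI _ (h j)⟩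
  let gQ : 𝒳.Q →ₛₗ[α] Q :=
    { toFun := fun x => ⟨g x, (hgQ x).2 x.2⟩
      map_add' := fun x y => Subtype.ext (map_add g _ _)
      map_smul' := fun s x => Subtype.ext (LinearMap.map_smulₛₗ g _ _) }
  have hgQs : Function.Surjective gQ := fun y => by
    obtain ⟨x, hx⟩ := hg y
    exact ⟨⟨x, (hgQ x).1 (hx ▸ y.2)⟩, Subtype.ext hx⟩
  have hker : ∀ x ∈ RingHom.ker α • (⊤ : Submodule S 𝒳.P), g x = 0 := fun x hx =>
    funext ((b.mem_ideal_smul_top_iff _ _).1 hx)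
  have hpre : ∀ x, g x = 0 → x ∈ 𝓕.preimage (RingHom.ker α) • (⊤ : Submodule S 𝒳.P) := fun x hx =>
    Submodule.smul_mono_left hα.ker_le_preimage (hg0 x hx)
  obtain ⟨F, hF⟩ := exists_semilinear_desc (τ := 𝓕'.f) hα.surjective g hg
    (g.toAddMonoidHom.comp 𝒳.F.toAddMonoidHom)
    (fun s x => by simp [hα.commf])
    (fun x hx => hker _ (𝒳.F_mem (hpre x hx)))
  obtain ⟨F₁, hF₁⟩ := exists_semilinear_desc (τ := 𝓕'.f) hα.surjective gQ hgQs
    (g.toAddMonoidHom.comp 𝒳.F₁.toAddMonoidHom)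
    (fun s x => by simp [hα.commf])
    (fun x hx => by
      have h₁ := hker _ (𝒳.F₁ext_mem (hpre x (congrArg Subtype.val hx)))
      rwa [𝒳.F₁ext_of_mem x.2] at h₁)
  replace hF : ∀ x, F (g x) = g (𝒳.F x) := hF
  replace hF₁ : ∀ x, F₁ (gQ x) = g (𝒳.F₁ x) := hF₁
  have hW : IsWindow 𝓕' Q F F₁ :=
    { smul_le := Submodule.smul_le.2 fun a ha y _ j => 𝓕'.I.mul_mem_right _ ha
      quot_free := by
        let r : (Fin m ⊕ Fin n → S') →ₗ[S'] (Fin n → S' ⧸ 𝓕'.I) :=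
          LinearMap.pi fun j => (Submodule.mkQ 𝓕'.I) ∘ₗ LinearMap.proj (Sum.inr j)
        have hr : Function.Surjective r := fun y => by
          choose x hx using fun j => Submodule.mkQ_surjective 𝓕'.I (y j)
          exact ⟨Sum.elim 0 x, funext hx⟩
        have hrQ : Q = LinearMap.ker r := by
          ext v
          simp [Q, r, funext_iff, Ideal.Quotient.eq_zero_iff_mem]
        exact ⟨n, ⟨(Submodule.quotEquivOfEq _ _ hrQ).trans (r.quotKerEquivOfSurjective hr)⟩⟩
      F₁_smul := by
        rintro ⟨a, ha⟩ y
        obtain ⟨a, rfl⟩ := hα.surjective a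
        obtain ⟨x, rfl⟩ := hg y
        have ha' := hα.mem_I a ha
        have h₁ := hF₁ ⟨a • x, 𝒳.smul_mem_Q ha' x⟩
        rw [𝒳.F₁_smul_eq ha', LinearMap.map_smulₛₗ, ← hα.f₁_apply, ← hF] at h₁
        rw [← h₁]
        congr 1
        exact Subtype.ext (LinearMap.map_smulₛₗ g a x).symm
      span_F₁ := by
        rw [← top_le_iff]
        intro y _
        obtain ⟨x, rfl⟩ := hg y
        have hx : x ∈ Submodule.span S (Set.range 𝒳.F₁) := 𝒳.isWindow.span_F₁ ▸ Submodule.mem_top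
        refine Submodule.span_induction ?_ ?_ ?_ ?_ hx
        · rintro _ ⟨z, rfl⟩
          exact Submodule.subset_span ⟨gQ z, hF₁ z⟩
        · rw [map_zero]
          exact zero_mem _
        · intro y z _ _ hy hz
          rw [map_add]
          exact Submodule.add_mem _ hy hz
        · intro s y _ hy
          rw [LinearMap.map_smulₛₗ]
          exact Submodule.smul_mem _ _ hy }
  let 𝒵 : Window 𝓕' := ⟨Fin m ⊕ Fin n → S', Q, F, F₁, hW⟩
  exact ⟨𝒵, ⟨g, fun x hx => (hgQ x).2 hx, hF, fun x hx => (hF₁ x).trans (one_smul _ _).symm⟩,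
    hg, hg0, fun x => (hgQ x).1⟩

/-- Every window over the target of a surjective homomorphism of frames is a base change. -/
theorem exists_isBaseChange_target (hα : IsSurjectiveFrameHom 𝓕 𝓕' α) (𝒵 : Window 𝓕') :
    ∃ (𝒳 : Window 𝓕) (g : AlphaHom 1 α 𝒳 𝒵), g.IsBaseChange := by
  have := 𝓕.isLocal
  obtain ⟨m, n, b, hb⟩ := 𝒵.isWindow.exists_adapted_basis hα.I_ne_top
  obtain ⟨θ, hθ⟩ := 𝓕.exists_f_eq_mul_f₁
  let g : (Fin m ⊕ Fin n → S) →ₛₗ[α] 𝒵.P :=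
    { toFun := fun x => ∑ i, α (x i) • b i
      map_add' := fun x y => by simp [add_smul, Finset.sum_add_distrib]
      map_smul' := fun s x => by simp [Finset.smul_sum, mul_smul] }
  have hgr : ∀ x i, b.repr (g x) i = α (x i) := fun x i => by
    simp only [g, LinearMap.coe_mk, AddHom.coe_mk, b.repr_sum_self]
  have hg : Function.Surjective g := fun y => by
    choose z hz using fun i => hα.surjective (b.repr y i)
    exact ⟨z, b.ext_elem fun i => by rw [hgr, hz]⟩
  have hg0 : ∀ x, g x = 0 → x ∈ RingHom.ker α • (⊤ : Submodule S (Fin m ⊕ Fin n → S)) :=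
    fun x hx => ((Pi.basisFun S _).mem_ideal_smul_top_iff _ _).2 fun i => by
      rw [Pi.basisFun_repr, RingHom.mem_ker, ← hgr, hx, map_zero, Finsupp.zero_apply]
  let Q : Submodule S (Fin m ⊕ Fin n → S) :=
    { carrier := {y | ∀ j, y (Sum.inr j) ∈ 𝓕.I}
      add_mem' := fun h h' j => 𝓕.I.add_mem (h j) (h' j)
      zero_mem' := fun j => 𝓕.I.zero_mem
      smul_mem' := fun s y h j => 𝓕.I.mul_mem_left s (h j) }
  have hgQ : ∀ x, g x ∈ 𝒵.Q ↔ x ∈ Q := fun x => by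
    rw [hb]
    simp only [hgr]
    exact ⟨fun h j => hα.mem_I _ (h j), fun h j => hα.mapI _ (h j)⟩
  choose ψ hψ using fun i => hg (𝒵.op i (b i))
  let F : (Fin m ⊕ Fin n → S) →ₛₗ[𝓕.f] (Fin m ⊕ Fin n → S) :=
    { toFun := fun x => (∑ i, (θ * 𝓕.f (x (Sum.inl i))) • ψ (Sum.inl i)) +
        ∑ j, 𝓕.f (x (Sum.inr j)) • ψ (Sum.inr j)
      map_add' := fun x y => by
        simp only [Pi.add_apply, map_add, mul_add, add_smul, Finset.sum_add_distrib]
        abel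
      map_smul' := fun s x => by
        simp only [Pi.smul_apply, smul_eq_mul, map_mul, smul_add, Finset.smul_sum, smul_smul,
          mul_left_comm θ] }
  let F₁ : Q →ₛₗ[𝓕.f] (Fin m ⊕ Fin n → S) :=
    { toFun := fun x => (∑ i, 𝓕.f (x.1 (Sum.inl i)) • ψ (Sum.inl i)) +
        ∑ j, 𝓕.f₁ ⟨x.1 (Sum.inr j), x.2 j⟩ • ψ (Sum.inr j)
      map_add' := fun x y => by
        have h₁ : ∀ j, 𝓕.f₁ ⟨(x + y).1 (Sum.inr j), (x + y).2 j⟩ =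
            𝓕.f₁ ⟨x.1 (Sum.inr j), x.2 j⟩ + 𝓕.f₁ ⟨y.1 (Sum.inr j), y.2 j⟩ := fun j =>
          map_add 𝓕.f₁ ⟨x.1 (Sum.inr j), x.2 j⟩ ⟨y.1 (Sum.inr j), y.2 j⟩
        simp only [h₁]
        simp only [Submodule.coe_add, Pi.add_apply, map_add, add_smul, Finset.sum_add_distrib]
        abel
      map_smul' := fun s x => by
        have h₁ : ∀ j, 𝓕.f₁ ⟨(s • x).1 (Sum.inr j), (s • x).2 j⟩ =
            𝓕.f s * 𝓕.f₁ ⟨x.1 (Sum.inr j), x.2 j⟩ := fun j =>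
          LinearMap.map_smulₛₗ 𝓕.f₁ s ⟨x.1 (Sum.inr j), x.2 j⟩
        simp only [h₁]
        simp only [Submodule.coe_smul, Pi.smul_apply, smul_eq_mul, map_mul, smul_add,
          Finset.smul_sum, smul_smul] }
  have hF₁smul : ∀ (a : S) (ha : a ∈ 𝓕.I) (x : Fin m ⊕ Fin n → S) (h : a • x ∈ Q),
      F₁ ⟨a • x, h⟩ = 𝓕.f₁ ⟨a, ha⟩ • F x := fun a ha x h => by
    have h₁ : ∀ j, 𝓕.f₁ ⟨(a • x) (Sum.inr j), h j⟩ =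
        𝓕.f₁ ⟨a, ha⟩ * 𝓕.f (x (Sum.inr j)) := fun j => by
      rw [mul_comm]
      refine Eq.trans ?_ (LinearMap.map_smulₛₗ 𝓕.f₁ (x (Sum.inr j)) ⟨a, ha⟩)
      exact congrArg 𝓕.f₁ (Subtype.ext (mul_comm _ _))
    have h₂ : 𝓕.f a = θ * 𝓕.f₁ ⟨a, ha⟩ := hθ ⟨a, ha⟩
    simp only [F₁, F, LinearMap.coe_mk, AddHom.coe_mk, h₁]
    simp only [Pi.smul_apply, smul_eq_mul, map_mul, smul_add, Finset.smul_sum, smul_smul, h₂]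
    congr 1
    exact Finset.sum_congr rfl fun i _ => by congr 1; ring
  have hspan : Submodule.span S (Set.range ψ) = ⊤ := by
    have hJ : RingHom.ker α ≤ Ideal.jacobson ⊥ := by
      rw [IsLocalRing.jacobson_eq_maximalIdeal ⊥ bot_ne_top]
      exact hα.ker_le_I.trans (IsLocalRing.le_maximalIdeal hα.I_ne_top_source)
    rw [← top_le_iff]
    refine Submodule.le_of_le_smul_of_le_jacobson_bot (I := RingHom.ker α) Module.Finite.fg_top
      hJ ?_
    intro x _
    have hx : ∀ y ∈ Submodule.span S' (Set.range fun i => 𝒵.op i (b i)),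
        ∃ z ∈ Submodule.span S (Set.range ψ), g z = y := by
      intro y hy
      refine Submodule.span_induction ?_ ⟨0, zero_mem _, map_zero g⟩ ?_ ?_ hy
      · rintro _ ⟨i, rfl⟩
        exact ⟨ψ i, Submodule.subset_span ⟨i, rfl⟩, hψ i⟩
      · rintro _ _ _ _ ⟨z, hz, rfl⟩ ⟨z', hz', rfl⟩
        exact ⟨z + z', add_mem hz hz', map_add g _ _⟩
      · rintro s _ _ ⟨z, hz, rfl⟩
        obtain ⟨s, rfl⟩ := hα.surjective s
        exact ⟨s • z, Submodule.smul_mem _ _ hz, LinearMap.map_smulₛₗ g _ _⟩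
    obtain ⟨z, hz, hzx⟩ := hx (g x) (by rw [Window.span_op_eq_top hb]; trivial)
    rw [← add_sub_cancel z x]
    exact Submodule.add_mem_sup hz (hg0 _ (by rw [map_sub, hzx, sub_self]))
  have hW : IsWindow 𝓕 Q F F₁ :=
    { smul_le := Submodule.smul_le.2 fun a ha y _ j => 𝓕.I.mul_mem_right _ ha
      quot_free := by
        let r : (Fin m ⊕ Fin n → S) →ₗ[S] (Fin n → S ⧸ 𝓕.I) :=
          LinearMap.pi fun j => (Submodule.mkQ 𝓕.I) ∘ₗ LinearMap.proj (Sum.inr j)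
        have hr : Function.Surjective r := fun y => by
          choose x hx using fun j => Submodule.mkQ_surjective 𝓕.I (y j)
          exact ⟨Sum.elim 0 x, funext hx⟩
        have hrQ : Q = LinearMap.ker r := by
          ext v
          simp [Q, r, funext_iff, Ideal.Quotient.eq_zero_iff_mem]
        exact ⟨n, ⟨(Submodule.quotEquivOfEq _ _ hrQ).trans (r.quotKerEquivOfSurjective hr)⟩⟩
      F₁_smul := fun a x => hF₁smul a a.2 x _
      span_F₁ := by
        rw [← top_le_iff, ← hspan, Submodule.span_le]
        rintro _ ⟨i | j, rfl⟩
        · refine Submodule.subset_span ⟨⟨Pi.single (Sum.inl i) 1, fun j => by simp⟩, ?_⟩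
          have h₁ : ∀ j : Fin n, ∀ h, 𝓕.f₁ ⟨(Pi.single (Sum.inl i) 1 : Fin m ⊕ Fin n → S)
              (Sum.inr j), h⟩ = 0 := fun j h => by
            refine Eq.trans (congrArg 𝓕.f₁ (Subtype.ext ?_)) (map_zero 𝓕.f₁)
            simp
          simp only [F₁, LinearMap.coe_mk, AddHom.coe_mk, h₁]
          rw [Finset.sum_eq_single i (fun k _ hk => by simp [hk]) (by simp)]
          simp
        · have hF : F (Pi.single (Sum.inr j) 1) = ψ (Sum.inr j) := by
            simp only [F, LinearMap.coe_mk, AddHom.coe_mk]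
            rw [Finset.sum_eq_single j (fun k _ hk => by simp [hk]) (by simp)]
            simp
          have h1 : (1 : S) ∈ Ideal.span (Set.range 𝓕.f₁) := by rw [𝓕.span_f₁]; trivial
          have hle : Ideal.span (Set.range 𝓕.f₁) ≤ (Submodule.span S (Set.range F₁)).comap
              (LinearMap.toSpanSingleton S _ (ψ (Sum.inr j))) := by
            rw [Ideal.span_le]
            rintro _ ⟨a, rfl⟩
            refine Submodule.subset_span ⟨⟨(a : S) • Pi.single (Sum.inr j) 1, fun k =>
              𝓕.I.mul_mem_right _ a.2⟩, ?_⟩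
            rw [hF₁smul a a.2, hF]
            rfl
          simpa using hle h1 }
  let 𝒳 : Window 𝓕 := ⟨Fin m ⊕ Fin n → S, Q, F, F₁, hW⟩
  refine ⟨𝒳, AlphaHom.ofF₁ext (𝒳 := 𝒳) hα g (fun x => (hgQ x).2) fun x hx => ?_, hg, hg0,
    fun x => (hgQ x).1⟩
  have hx' := (hgQ x).2 hx
  rw [𝒳.F₁ext_of_mem hx, 𝒵.F₁ext_of_mem hx', Window.F₁_eq_sum hb]
  have h₁ : ∀ j, ∀ h, 𝓕'.f₁ ⟨b.repr (g x) (Sum.inr j), h⟩ = α (𝓕.f₁ ⟨x (Sum.inr j), hx j⟩) :=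
    fun j h => by
      rw [← hα.f₁_apply]
      exact congrArg 𝓕'.f₁ (Subtype.ext (hgr _ _))
  change _ = g ((∑ i, 𝓕.f (x (Sum.inl i)) • ψ (Sum.inl i)) +
        ∑ j, 𝓕.f₁ ⟨x (Sum.inr j), hx j⟩ • ψ (Sum.inr j))
  simp only [h₁]
  simp only [hgr, map_add, map_sum, LinearMap.map_smulₛₗ, hψ, hα.commf]

end AlphaHom

open AlphaHom in
/-- A surjective homomorphism of frames whose kernel is contracting is crystalline. -/
theorem IsSurjectiveFrameHom.isCrystalline {J : ℕ → Ideal S} (hα : IsSurjectiveFrameHom 𝓕 𝓕' α)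
    (hJ : 𝓕.IsContracting (RingHom.ker α) J) : IsCrystalline 𝓕 𝓕' 1 α := by
  choose obj ι hι using exists_isBaseChange hα
  have hdesc : ∀ {𝒳 : Window 𝓕} {𝒵 𝒵' : Window 𝓕'} {g : AlphaHom 1 α 𝒳 𝒵}, g.IsBaseChange →
      ∀ t : AlphaHom 1 α 𝒳 𝒵', ∃! h : 𝒵 ⟶ 𝒵', ∀ x, h.g (g.g x) = t.g x := fun hg t =>
    hg.existsUnique_desc hα.surjective t
  have hlift : ∀ {𝒳 𝒴 : Window 𝓕} {𝒵 : Window 𝓕'} {g : AlphaHom 1 α 𝒴 𝒵}, g.IsBaseChange →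
      ∀ t : AlphaHom 1 α 𝒳 𝒵, ∃! h : 𝒳 ⟶ 𝒴, ∀ x, g.g (h.g x) = t.g x := fun hg t =>
    hg.existsUnique_lift hα hJ t
  have hext : ∀ {𝒳 : Window 𝓕} {𝒵 𝒵' : Window 𝓕'} {g : AlphaHom 1 α 𝒳 𝒵}, g.IsBaseChange →
      ∀ h h' : 𝒵 ⟶ 𝒵', (∀ x, h.g (g.g x) = h'.g (g.g x)) → h = h' := fun {𝒳 𝒵 𝒵' g} hg h h' e =>
    (hdesc hg (AlphaHom.comp h' g)).unique e fun _ => rfl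
  choose map hmap _ using fun (𝒳 𝒴 : Window 𝓕) (h : 𝒳 ⟶ 𝒴) =>
    hdesc (hι 𝒳) (AlphaHom.precomp (ι 𝒴) h)
  replace hmap : ∀ (𝒳 𝒴 : Window 𝓕) (h : 𝒳 ⟶ 𝒴) (x : 𝒳.P),
      (map 𝒳 𝒴 h).g ((ι 𝒳).g x) = (ι 𝒴).g (h.g x) := hmap
  let G : CategoryTheory.Functor (Window 𝓕) (Window 𝓕') :=
    { obj := obj
      map := fun {𝒳 𝒴} h => map 𝒳 𝒴 h
      map_id := fun 𝒳 => hext (hι 𝒳) _ _ fun x => hmap _ _ _ _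
      map_comp := fun {𝒳 𝒴 𝒵} a c => hext (hι 𝒳) _ _ fun x => by
        refine (hmap _ _ _ _).trans ?_
        change _ = (map 𝒴 𝒵 c).g ((map 𝒳 𝒴 a).g _)
        rw [hmap, hmap]
        rfl }
  have hfaithful : G.Faithful := ⟨fun {𝒳 𝒴} h h' e =>
    (hlift (hι 𝒴) (AlphaHom.comp (G.map h') (ι 𝒳))).unique
      (fun x => by
        rw [← e]
        exact (hmap _ _ h x).symm)
      fun x => (hmap _ _ h' x).symm⟩
  have hfull : G.Full := ⟨fun {𝒳 𝒴} h => by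
    obtain ⟨h', hh', -⟩ := hlift (hι 𝒴) (AlphaHom.comp h (ι 𝒳))
    exact ⟨h', hext (hι 𝒳) _ _ fun x => (hmap _ _ h' x).trans (hh' x)⟩⟩
  have hess : G.EssSurj := ⟨fun 𝒵 => by
    obtain ⟨𝒳, g, hg⟩ := exists_isBaseChange_target hα 𝒵
    obtain ⟨h, hh, -⟩ := hdesc (hι 𝒳) g
    obtain ⟨h', hh', -⟩ := hdesc hg (ι 𝒳)
    refine ⟨𝒳, ⟨⟨h, h', hext (hι 𝒳) _ _ fun x => ?_, hext hg _ _ fun x => ?_⟩⟩⟩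
    · change h'.g (h.g _) = _
      rw [hh, hh']
      rfl
    · change h.g (h'.g _) = _
      rw [hh', hh]
      rfl⟩
  exact ⟨G, ι, fun 𝒳 𝒴 h x => hmap 𝒳 𝒴 h x, fun 𝒳 𝒵 g => hdesc (hι 𝒳) g, { }⟩

end FrameHom

section Witt

open WittVector

variable {p : ℕ} [Fact p.Prime] {R : Type} [CommRing R]

theorem WittVector.map_eq_map_iff {A : Type} [CommRing A] (φ : R →+* A) (x y : WittVector p R) :
    WittVector.map φ x = WittVector.map φ y ↔ ∀ i, φ (x.coeff i) = φ (y.coeff i) := by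
  simp only [WittVector.ext_iff, map_coeff]

theorem WittVector.map_eq_zero_iff_coeff {A : Type} [CommRing A] (φ : R →+* A)
    (x : WittVector p R) : WittVector.map φ x = 0 ↔ ∀ i, φ (x.coeff i) = 0 := by
  simp only [WittVector.ext_iff, map_coeff, zero_coeff]

theorem WittVector.map_mk_eq_zero_iff (𝔠 : Ideal R) (x : WittVector p R) :
    WittVector.map (Ideal.Quotient.mk 𝔠) x = 0 ↔ ∀ i, x.coeff i ∈ 𝔠 := by
  simp only [map_eq_zero_iff_coeff, Ideal.Quotient.eq_zero_iff_mem]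

theorem WittVector.map_frobenius {A : Type} [CommRing A] (φ : R →+* A) (x : WittVector p R) :
    WittVector.map φ (frobenius x) = frobenius (WittVector.map φ x) := by
  ext n
  rw [map_coeff, coeff_frobenius, coeff_frobenius, MvPolynomial.map_aeval, MvPolynomial.aeval_def,
    ← MvPolynomial.coe_eval₂Hom]
  exact MvPolynomial.eval₂Hom_congr (RingHom.ext_int _ _) (funext fun i => (map_coeff φ x i).symm)
    rfl

theorem WittVector.sub_coeff_zero (x y : WittVector p R) :
    (x - y).coeff 0 = x.coeff 0 - y.coeff 0 :=
  map_sub constantCoeff x y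

/-- Witt vectors over a quotient whose coefficients converge to zero can be lifted. -/
theorem MemHatW.exists_lift {𝔪 𝔟 : Ideal R} {d : WittVector p (R ⧸ 𝔟)}
    (hd : MemHatW p (𝔪.map (Ideal.Quotient.mk 𝔟)) (𝔪.map (Ideal.Quotient.mk 𝔟)) d) :
    ∃ e : WittVector p R, MemHatW p 𝔪 𝔪 e ∧ WittVector.map (Ideal.Quotient.mk 𝔟) e = d := by
  classical
  have hlift : ∀ i, ∃ r, Ideal.Quotient.mk 𝔟 r = d.coeff i ∧ r ∈ 𝔪 ∧
      ∀ n ≤ i, d.coeff i ∈ 𝔪.map (Ideal.Quotient.mk 𝔟) ^ n → r ∈ 𝔪 ^ n := by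
    intro i
    have h₁ : 1 ≤ i + 1 := by omega
    set m := Nat.findGreatest (fun n => d.coeff i ∈ 𝔪.map (Ideal.Quotient.mk 𝔟) ^ n) (i + 1)
    have hspec : d.coeff i ∈ 𝔪.map (Ideal.Quotient.mk 𝔟) ^ m :=
      Nat.findGreatest_spec (P := fun n => d.coeff i ∈ 𝔪.map (Ideal.Quotient.mk 𝔟) ^ n) h₁
        (by simpa using hd.1 i)
    have hle : ∀ n ≤ i + 1, d.coeff i ∈ 𝔪.map (Ideal.Quotient.mk 𝔟) ^ n → n ≤ m :=
      fun n hn h => Nat.le_findGreatest hn h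
    rw [← Ideal.map_pow, Ideal.mem_map_iff_of_surjective _ Ideal.Quotient.mk_surjective] at hspec
    obtain ⟨r, hr, hrd⟩ := hspec
    refine ⟨r, hrd, ?_, fun n hn h => Ideal.pow_le_pow_right (hle n (by omega) h) hr⟩
    simpa using Ideal.pow_le_pow_right (hle 1 h₁ (by simpa using hd.1 i)) hr
  choose r hr hr𝔪 hrn using hlift
  refine ⟨WittVector.mk p r, ⟨fun i => hr𝔪 i, fun n => ?_⟩, ?_⟩
  · filter_upwards [hd.2 n, eventually_ge_atTop n] with i hi hn
    exact hrn i n hn hi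
  · ext i
    exact hr i

namespace IsSpecialSubring

variable {k : Type} [CommRing k] {𝔪 𝔟 : Ideal R} {ρ : R →+* k} {T : Subring (WittVector p R)}

theorem mem_of_memHatW (hT : IsSpecialSubring p 𝔪 ρ T) (h𝔟 : 𝔟 ≤ 𝔪) {x : WittVector p R}
    (hx : MemHatW p 𝔪 𝔟 x) : x ∈ T :=
  ((hT.2.2 x).2 ⟨fun i => h𝔟 (hx.1 i), hx.2⟩).1

theorem memHatW (hT : IsSpecialSubring p 𝔪 ρ T) (h𝔟 : 𝔟 ≤ RingHom.ker ρ) {x : WittVector p R}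
    (hx : x ∈ T) (h : ∀ i, x.coeff i ∈ 𝔟) : MemHatW p 𝔪 𝔟 x :=
  ⟨h, ((hT.2.2 x).1 ⟨hx, (map_eq_zero_iff_coeff ρ x).2 fun i => h𝔟 (h i)⟩).2⟩

/-- The projection `𝕎(R) → 𝕎(R ⧸ 𝔟)` is surjective. -/
theorem surjective_of_map_mk (hT : IsSpecialSubring p 𝔪 ρ T) {ρ' : R ⧸ 𝔟 →+* k}
    (hρ' : ρ'.comp (Ideal.Quotient.mk 𝔟) = ρ) {T' : Subring (WittVector p (R ⧸ 𝔟))}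
    (hT' : IsSpecialSubring p (𝔪.map (Ideal.Quotient.mk 𝔟)) ρ' T') {α : T →+* T'}
    (hα : ∀ x : T, (α x : WittVector p (R ⧸ 𝔟)) = WittVector.map (Ideal.Quotient.mk 𝔟) x) :
    Function.Surjective α := by
  intro y
  obtain ⟨x, hx, hxy⟩ := hT.2.1 (WittVector.map ρ' y)
  have hd := (hT'.2.2 (WittVector.map (Ideal.Quotient.mk 𝔟) x - y)).1
    ⟨sub_mem (hα ⟨x, hx⟩ ▸ (α ⟨x, hx⟩).2) y.2, by
      rw [map_sub, ← hxy, sub_eq_zero, WittVector.ext_iff]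
      intro i
      simp only [map_coeff, ← hρ', RingHom.comp_apply]⟩
  obtain ⟨e, he, hed⟩ := hd.exists_lift
  refine ⟨⟨x - e, sub_mem hx (hT.mem_of_memHatW le_rfl he)⟩, Subtype.ext ?_⟩
  rw [hα, map_sub, hed, sub_sub_cancel]

end IsSpecialSubring

/-- A sequence in an adically complete ring whose differences tend to zero converges, with the
expected estimate on the distance to the limit. -/
theorem IsPrecomplete.exists_limit (𝔪 : Ideal R) [IsPrecomplete 𝔪 R] (c : ℕ → R)
    (hc : ∀ k, ∀ᶠ n in atTop, c (n + 1) - c n ∈ 𝔪 ^ k) :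
    ∃ l, ∀ k N, (∀ n ≥ N, c (n + 1) - c n ∈ 𝔪 ^ k) → l - c N ∈ 𝔪 ^ k := by
  have htel : ∀ k N, (∀ n ≥ N, c (n + 1) - c n ∈ 𝔪 ^ k) → ∀ n ≥ N, c n - c N ∈ 𝔪 ^ k := by
    intro k N h n hn
    induction n, hn using Nat.le_induction with
    | base => simp
    | succ n hn ih => simpa using add_mem (h n hn) ih
  have htwo : ∀ k N M, (∀ n ≥ N, c (n + 1) - c n ∈ 𝔪 ^ k) → (∀ n ≥ M, c (n + 1) - c n ∈ 𝔪 ^ k) →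
      c M - c N ∈ 𝔪 ^ k := fun k N M hN hM => by
    simpa using sub_mem (htel k N hN _ (le_max_left N M)) (htel k M hM _ (le_max_right N M))
  choose M hM using fun k => eventually_atTop.1 (hc k)
  obtain ⟨l, hl⟩ := IsPrecomplete.prec' (I := 𝔪) (fun k => c (M k)) fun {m n} hmn => by
    rw [SModEq.sub_mem, smul_eq_mul, Ideal.mul_top]
    exact htwo m _ _ (fun i hi => Ideal.pow_le_pow_right hmn (hM n i hi)) (hM m)
  refine ⟨l, fun k N hN => ?_⟩
  have h₁ := hl k
  rw [SModEq.sub_mem, smul_eq_mul, Ideal.mul_top] at h₁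
  simpa using sub_mem (htwo k N (M k) hN (hM k)) h₁

/-- The kernel of `𝕎(R) → 𝕎(R ⧸ 𝔟)` is contracting when `f₁` acts on it as the coordinate shift. -/
theorem IsSpecialSubring.isContracting {k : Type} [CommRing k] [IsLocalRing R]
    [IsNoetherianRing R] [IsAdicComplete (IsLocalRing.maximalIdeal R) R] {𝔟 : Ideal R}
    {ρ : R →+* k} {T : Subring (WittVector p R)}
    (hT : IsSpecialSubring p (IsLocalRing.maximalIdeal R) ρ T)
    (h𝔟 : 𝔟 ≤ IsLocalRing.maximalIdeal R) (h𝔟ρ : 𝔟 ≤ RingHom.ker ρ) {𝓕 : Frame T}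
    {𝔞 : Ideal T} (h𝔞 : ∀ x : T, x ∈ 𝔞 ↔ ∀ i, (x : WittVector p R).coeff i ∈ 𝔟)
    (hI : 𝔞 ≤ 𝓕.I)
    (hf₁ : ∀ x : 𝓕.I, (x : T) ∈ 𝔞 →
      ∀ i, ((𝓕.f₁ x : T) : WittVector p R).coeff i = ((x : T) : WittVector p R).coeff (i + 1)) :
    𝓕.IsContracting 𝔞 fun n => RingHom.ker ((WittVector.map
      (Ideal.Quotient.mk (𝔟 ⊓ IsLocalRing.maximalIdeal R ^ n))).comp T.subtype) := by
  set 𝔪 := IsLocalRing.maximalIdeal R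
  have hJ : ∀ n (x : T), x ∈ RingHom.ker ((WittVector.map
      (Ideal.Quotient.mk (𝔟 ⊓ 𝔪 ^ n))).comp T.subtype) ↔
      ∀ i, (x : WittVector p R).coeff i ∈ 𝔟 ⊓ 𝔪 ^ n := fun n x => by
    rw [RingHom.mem_ker, RingHom.comp_apply, Subring.subtype_apply, map_mk_eq_zero_iff]
  have hhat : ∀ x ∈ 𝔞, MemHatW p 𝔪 𝔟 (x : WittVector p R) := fun x hx =>
    hT.memHatW h𝔟ρ x.2 ((h𝔞 x).1 hx)
  have hshift : ∀ x (h : x ∈ 𝔞), 𝓕.f₁ ⟨x, hI h⟩ ∈ 𝔞 := fun x h => (h𝔞 _).2 fun i => by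
    rw [hf₁ ⟨x, hI h⟩ h]
    exact (h𝔞 x).1 h _
  have hJ𝔞 : ∀ n, RingHom.ker ((WittVector.map
      (Ideal.Quotient.mk (𝔟 ⊓ 𝔪 ^ n))).comp T.subtype) ≤ 𝔞 := fun n x hx =>
    (h𝔞 x).2 fun i => ((hJ n x).1 hx i).1
  refine ⟨fun x hx => 𝓕.mem_preimage.2 ⟨hI hx, hshift x hx⟩, fun n x hx => ?_, fun n => ?_,
    fun x hx => ?_, fun u hu hu0 => ?_⟩
  · refine 𝓕.mem_preimage.2 ⟨hI (hJ𝔞 n hx), (hJ n _).2 fun i => ?_⟩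
    rw [hf₁ ⟨x, hI (hJ𝔞 n hx)⟩ (hJ𝔞 n hx)]
    exact (hJ n x).1 hx _
  · have hind : ∀ N, ∀ x ∈ 𝔞, (∀ i ≥ N, (x : WittVector p R).coeff i ∈ 𝔪 ^ n) →
        x ∈ 𝓕.preimage^[N] (RingHom.ker ((WittVector.map
          (Ideal.Quotient.mk (𝔟 ⊓ 𝔪 ^ n))).comp T.subtype)) := by
      intro N
      induction N with
      | zero => exact fun x hx h => (hJ n x).2 fun i => ⟨(h𝔞 x).1 hx i, h i i.zero_le⟩
      | succ N ih =>
        intro x hx h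
        rw [Function.iterate_succ_apply']
        refine 𝓕.mem_preimage.2 ⟨hI hx, ih _ (hshift x hx) fun i hi => ?_⟩
        rw [hf₁ ⟨x, hI hx⟩ hx]
        exact h _ (by omega)
    intro x hx
    obtain ⟨N, hN⟩ := eventually_atTop.1 ((hhat x hx).2 n)
    filter_upwards [eventually_ge_atTop N] with M hM
    exact hind M x hx fun i hi => hN i (hM.trans hi)
  · rw [← ZeroMemClass.coe_eq_zero, WittVector.ext_iff]
    intro i
    rw [zero_coeff]
    refine IsHausdorff.haus' (I := 𝔪) (M := R) _ fun n => ?_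
    rw [SModEq.zero, smul_eq_mul, Ideal.mul_top]
    exact ((hJ n x).1 (hx n) i).2
  · set s : ℕ → T := fun n => ∑ i ∈ Finset.range n, u i with hs
    have hs𝔞 : ∀ n, s n ∈ 𝔞 := fun n => sum_mem fun i _ => hu i
    have hstep : ∀ n k, u n ∈ RingHom.ker ((WittVector.map
        (Ideal.Quotient.mk (𝔟 ⊓ 𝔪 ^ k))).comp T.subtype) → ∀ i,
        (s (n + 1) : WittVector p R).coeff i - (s n : WittVector p R).coeff i ∈ 𝔪 ^ k := by
      intro n k hn i
      have h₁ : WittVector.map (Ideal.Quotient.mk (𝔟 ⊓ 𝔪 ^ k)) (s (n + 1) : WittVector p R) =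
          WittVector.map (Ideal.Quotient.mk (𝔟 ⊓ 𝔪 ^ k)) (s n : WittVector p R) := by
        rw [hs]
        simp only [Finset.sum_range_succ, Subring.coe_add, map_add]
        rw [add_eq_left]
        exact hn
      exact (Ideal.Quotient.eq.1 ((map_eq_map_iff _ _ _).1 h₁ i)).2
    choose N hN using fun k => eventually_atTop.1 (hu0 k)
    choose l hl using fun i => IsPrecomplete.exists_limit 𝔪
      (fun n => (s n : WittVector p R).coeff i)
      fun k => eventually_atTop.2 ⟨N k, fun n hn => hstep n k (hN k n hn) i⟩
    have hlN : ∀ k, ∀ n ≥ N k, ∀ i, l i - (s n : WittVector p R).coeff i ∈ 𝔪 ^ k :=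
      fun k n hn i => hl i k n fun m hm => hstep m k (hN k m (hn.trans hm)) i
    have hl𝔟 : ∀ i, l i ∈ 𝔟 := fun i => by
      rw [← Ideal.Quotient.eq_zero_iff_mem]
      refine IsHausdorff.haus' (I := 𝔪) (M := R ⧸ 𝔟) _ fun k => ?_
      rw [SModEq.zero]
      have h₁ := hlN k (N k) le_rfl i
      have h₂ : Ideal.Quotient.mk 𝔟 (l i) =
          (l i - (s (N k) : WittVector p R).coeff i) • (1 : R ⧸ 𝔟) := by
        rw [Algebra.smul_def, mul_one, Ideal.Quotient.algebraMap_eq, map_sub,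
          Ideal.Quotient.eq_zero_iff_mem.2 ((h𝔞 _).1 (hs𝔞 (N k)) i), sub_zero]
      rw [h₂]
      exact Submodule.smul_mem_smul h₁ Submodule.mem_top
    have hlhat : MemHatW p 𝔪 𝔟 (WittVector.mk p l) := ⟨hl𝔟, fun k => by
      filter_upwards [(hhat _ (hs𝔞 (N k))).2 k] with i hi
      simpa using add_mem (hlN k (N k) le_rfl i) hi⟩
    refine ⟨⟨WittVector.mk p l, hT.mem_of_memHatW h𝔟 hlhat⟩, (h𝔞 _).2 hl𝔟, fun k => ?_⟩
    filter_upwards [eventually_ge_atTop (N k)] with n hn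
    rw [RingHom.mem_ker, map_sub, sub_eq_zero]
    refine (map_eq_map_iff _ _ _).2 fun i => Ideal.Quotient.eq.2 ⟨?_, hlN k n hn i⟩
    exact sub_mem (hl𝔟 i) ((h𝔞 _).1 (hs𝔞 n) i)

end Witt

set_option synthInstance.maxHeartbeats 1000000 in
set_option maxHeartbeats 1000000 in
open WittVector in
/-- reformulation of Zink's Theorem 3 / Proposition `PrCrysDieu`.
For `𝔟² = 0`, the morphism of frames `α₂ : 𝓕' = (𝕎(R), Ĩ, R', f, f̃₁) → 𝓕_{R'}`
induced by the projection `𝕎(R) → 𝕎(R')` is crystalline. -/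
theorem tilde_frame_to_dieudonne_crystalline (p : ℕ) [Fact p.Prime] (hp3 : 3 ≤ p)
    (R : Type) [CommRing R] [IsLocalRing R] [IsNoetherianRing R]
    [IsAdicComplete (IsLocalRing.maximalIdeal R) R]
    (k : Type) [Field k] [CharP k p] [PerfectRing k p]
    (ρ : R →+* k) (hρ : Function.Surjective ρ)
    (hker : RingHom.ker ρ = IsLocalRing.maximalIdeal R)
    (𝔟 : Ideal R) (h𝔟 : 𝔟 ≤ IsLocalRing.maximalIdeal R) (hsq : 𝔟 * 𝔟 = ⊥)
    (T : Subring (WittVector p R))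
    (hT : IsSpecialSubring p (IsLocalRing.maximalIdeal R) ρ T)
    (T' : Subring (WittVector p (R ⧸ 𝔟)))
    (hT' : IsSpecialSubring p ((IsLocalRing.maximalIdeal R).map (Ideal.Quotient.mk 𝔟))
      (Ideal.Quotient.lift 𝔟 ρ (fun a ha => by
        rw [← RingHom.mem_ker, hker]; exact h𝔟 ha)) T')
    -- the frame `𝓕' = (𝕎(R), Ĩ, R', f, f̃₁)`
    (𝓕' : Frame T)
    (hI : ∀ x : T, x ∈ 𝓕'.I ↔ ∃ a b : WittVector p R,
      (a ∈ T ∧ a.coeff 0 = 0) ∧ MemHatW p (IsLocalRing.maximalIdeal R) 𝔟 b ∧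
      (x : WittVector p R) = a + b)
    (hf : ∀ x : T, ((𝓕'.f x : T) : WittVector p R) = frobenius (x : WittVector p R))
    (hf₁v : ∀ x : 𝓕'.I, ((x : T) : WittVector p R).coeff 0 = 0 →
      verschiebung ((𝓕'.f₁ x : T) : WittVector p R) = ((x : T) : WittVector p R))
    (hf₁s : ∀ x : 𝓕'.I, MemHatW p (IsLocalRing.maximalIdeal R) 𝔟 ((x : T) : WittVector p R) →
      ∀ i, ((𝓕'.f₁ x : T) : WittVector p R).coeff i = ((x : T) : WittVector p R).coeff (i + 1))
    -- the Dieudonné frame `𝓕_{R'} = (𝕎(R'), 𝕀_{R'}, R', f, v⁻¹)`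
    (𝓕'' : Frame T')
    (hI'' : ∀ x : T', x ∈ 𝓕''.I ↔ (x : WittVector p (R ⧸ 𝔟)).coeff 0 = 0)
    (hf'' : ∀ x : T', ((𝓕''.f x : T') : WittVector p (R ⧸ 𝔟))
      = frobenius (x : WittVector p (R ⧸ 𝔟)))
    (hf₁'' : ∀ x : 𝓕''.I, verschiebung ((𝓕''.f₁ x : T') : WittVector p (R ⧸ 𝔟))
      = ((x : T') : WittVector p (R ⧸ 𝔟)))
    -- `α₂` is induced by the projection `𝕎(R) → 𝕎(R')`
    (α₂ : T →+* T')
    (hα₂ : ∀ x : T, (α₂ x : WittVector p (R ⧸ 𝔟))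
      = WittVector.map (Ideal.Quotient.mk 𝔟) (x : WittVector p R)) :
    IsCrystalline 𝓕' 𝓕'' 1 α₂ := by
  have h𝔟ρ : 𝔟 ≤ RingHom.ker ρ := hker ▸ h𝔟
  have hkerα : ∀ x : T, x ∈ RingHom.ker α₂ ↔ ∀ i, (x : WittVector p R).coeff i ∈ 𝔟 := fun x => by
    rw [RingHom.mem_ker, ← map_mk_eq_zero_iff, ← hα₂, ZeroMemClass.coe_eq_zero]
  have hhat : ∀ x ∈ RingHom.ker α₂, MemHatW p (IsLocalRing.maximalIdeal R) 𝔟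
      (x : WittVector p R) := fun x hx => hT.memHatW h𝔟ρ x.2 ((hkerα x).1 hx)
  have hkerI : RingHom.ker α₂ ≤ 𝓕'.I := fun x hx =>
    (hI x).2 ⟨0, x, ⟨T.zero_mem, zero_coeff _ _ _⟩, hhat x hx, (zero_add _).symm⟩
  have hf₁ker : ∀ x : 𝓕'.I, (x : T) ∈ RingHom.ker α₂ → 𝓕'.f₁ x ∈ RingHom.ker α₂ :=
    fun x hx => (hkerα _).2 fun i => by
      rw [hf₁s x (hhat x hx)]
      exact (hkerα x).1 hx _
  have hcoeff : ∀ x : T, (α₂ x : WittVector p (R ⧸ 𝔟)).coeff 0 = 0 ↔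
      (x : WittVector p R).coeff 0 ∈ 𝔟 := fun x => by
    rw [hα₂, map_coeff, Ideal.Quotient.eq_zero_iff_mem]
  have hmapI : ∀ x ∈ 𝓕'.I, α₂ x ∈ 𝓕''.I := fun x hx => by
    obtain ⟨a, b, ⟨-, ha⟩, hb, hab⟩ := (hI x).1 hx
    rw [hI'', hcoeff, hab, add_coeff_zero, ha, zero_add]
    exact hb.1 0
  have hf₁add : ∀ (x : 𝓕'.I) (a b : T), (x : T) = a + b → (a : WittVector p R).coeff 0 = 0 →
      b ∈ RingHom.ker α₂ → ∀ h, 𝓕''.f₁ ⟨α₂ x, h⟩ = α₂ (𝓕'.f₁ x) := by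
    intro x a b hab ha hb h
    have ha' : a ∈ 𝓕'.I := by
      rw [eq_sub_of_add_eq hab.symm]
      exact sub_mem x.2 (hkerI hb)
    have hx : x = ⟨a, ha'⟩ + ⟨b, hkerI hb⟩ := Subtype.ext hab
    have hαx : α₂ x = α₂ a := by rw [hab, map_add, RingHom.mem_ker.1 hb, add_zero]
    have hf₁x : α₂ (𝓕'.f₁ x) = α₂ (𝓕'.f₁ ⟨a, ha'⟩) := by
      rw [hx, map_add, map_add, RingHom.mem_ker.1 (hf₁ker ⟨b, hkerI hb⟩ hb), add_zero]
    refine Subtype.ext (verschiebung_injective p (R ⧸ 𝔟) ?_)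
    rw [hf₁'', hf₁x, hα₂ (𝓕'.f₁ _), ← map_verschiebung, hf₁v ⟨a, ha'⟩ ha, ← hα₂]
    exact congrArg Subtype.val hαx
  have hα : IsSurjectiveFrameHom 𝓕' 𝓕'' α₂ :=
    { mapI := hmapI
      commf := fun x => Subtype.ext <| by
        rw [hf'', hα₂, hα₂, hf, WittVector.map_frobenius]
      commf₁ := fun x h => by
        obtain ⟨a, b, ⟨haT, ha⟩, hb, hab⟩ := (hI x).1 x.2
        have hbα : (⟨b, hT.mem_of_memHatW h𝔟 hb⟩ : T) ∈ RingHom.ker α₂ := (hkerα _).2 hb.1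
        have hsum : (x : T) = ⟨a, haT⟩ + ⟨b, hT.mem_of_memHatW h𝔟 hb⟩ := Subtype.ext hab
        rw [one_mul]
        exact hf₁add x _ _ hsum ha hbα h
      surjective := hT.surjective_of_map_mk (Ideal.Quotient.lift_comp_mk _ _ _) hT' hα₂
      mem_I := fun x hx => by
        rw [hI'', hcoeff] at hx
        have ht : MemHatW p (IsLocalRing.maximalIdeal R) 𝔟
            (teichmuller p ((x : WittVector p R).coeff 0)) := by
          refine ⟨fun i => ?_, fun n => ?_⟩
          · rcases Nat.eq_zero_or_pos i with rfl | hi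
            · rwa [teichmuller_coeff_zero]
            · rw [teichmuller_coeff_pos _ _ _ hi]
              exact 𝔟.zero_mem
          · filter_upwards [eventually_gt_atTop 0] with i hi
            rw [teichmuller_coeff_pos _ _ _ hi]
            exact zero_mem _
        refine (hI x).2 ⟨x - teichmuller p ((x : WittVector p R).coeff 0), _,
          ⟨sub_mem x.2 (hT.mem_of_memHatW h𝔟 ht), ?_⟩, ht, (sub_add_cancel _ _).symm⟩
        rw [sub_coeff_zero, teichmuller_coeff_zero, sub_self]
      I_ne_top := fun h => by
        have h₁ : (1 : T') ∈ 𝓕''.I := h ▸ Submodule.mem_top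
        have : Nontrivial (R ⧸ 𝔟) := Ideal.Quotient.nontrivial_iff.2 fun h =>
          (IsLocalRing.maximalIdeal.isMaximal R).ne_top (top_le_iff.1 (h ▸ h𝔟))
        rw [hI'', Subring.coe_one, one_coeff_zero] at h₁
        exact one_ne_zero h₁ }
  exact hα.isCrystalline (hT.isContracting h𝔟 h𝔟ρ hkerα hkerI fun x hx => hf₁s x (hhat x hx))
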